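/- Let α∈(0,1) and θ∈ℝ with α+θ>0, let (K_n,(K_{r,n})_{r≥1}) be the Ewens–Pitman block-counting chain with parameters (α,θ), and fix an integer d≥1. Then the random vector in ℝ^d whose r-th component (1≤r≤d) is √(K_n)·(∑_{i=1}^r b_{r,i}P_{i,n} + (−1)^r p_α(r)) converges in distribution, as n→∞, to a centered d-dimensional Gaussian distribution with covariance matrix Λ_d, where Λ_{i,j} = ((−1)^{i+j}(i+j)!/(i!j!))·p_α(i+j). -/

import Mathlib

open MeasureTheory ProbabilityTheory Filter Topology

noncomputable section

/-- Rising factorial `(a)^(m) = a (a+1) ⋯ (a+m-1)` of a real number. -/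
def risingFactorial (a : ℝ) : ℕ → ℝ
  | 0 => 1
  | m + 1 => risingFactorial a m * (a + m)

/-- Sibuya probabilities `p_α(r) = α (1-α)^(r-1) / r!` for `r ≥ 1`. -/
def sibuya (α : ℝ) (r : ℕ) : ℝ :=
  α * risingFactorial (1 - α) (r - 1) / (Nat.factorial r : ℝ)

/-- The Ewens–Pitman block-counting chain with parameters `(α, θ)` on a probability space
`(Ω, μ)` with filtration `F`: for `n ≥ 1`, `K n` is the number of blocks and `B r n` the
number of blocks of size `r` of the Ewens–Pitman random partition of `{1,…,n}`.
It starts from `K 1 = 1`, `B 1 1 = 1`, `B r 1 = 0` for `r ≥ 2`, and the transition from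
time `n` to `n+1` creates a new block with conditional probability `(α K n + θ)/(n + θ)`,
and grows a block of size `r` to size `r+1` with conditional probability
`(r - α) B r n / (n + θ)`. -/
structure IsEwensPitman (α θ : ℝ) {Ω : Type*} {mΩ : MeasurableSpace Ω}
    (μ : Measure Ω) (F : Filtration ℕ mΩ) (K : ℕ → Ω → ℕ) (B : ℕ → ℕ → Ω → ℕ) :
    Prop where
  prob : IsProbabilityMeasure μ
  meas_K : ∀ n, Measurable[F n] (K n)
  meas_B : ∀ r n, Measurable[F n] (B r n)
  init_K : ∀ᵐ ω ∂μ, K 1 ω = 1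
  init_B1 : ∀ᵐ ω ∂μ, B 1 1 ω = 1
  init_B : ∀ r, 2 ≤ r → ∀ᵐ ω ∂μ, B r 1 ω = 0
  B_eq_zero : ∀ r n, n < r → ∀ᵐ ω ∂μ, B r n ω = 0
  sum_blocks : ∀ n, 1 ≤ n → ∀ᵐ ω ∂μ, K n ω = ∑ r ∈ Finset.Icc 1 n, B r n ω
  sum_sizes : ∀ n, 1 ≤ n → ∀ᵐ ω ∂μ, n = ∑ r ∈ Finset.Icc 1 n, r * B r n ω
  trans_new : ∀ n, 1 ≤ n →
    μ[Set.indicator {ω | K (n+1) ω = K n ω + 1 ∧ B 1 (n+1) ω = B 1 n ω + 1 ∧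
        ∀ s, 2 ≤ s → B s (n+1) ω = B s n ω} (fun _ => (1:ℝ)) | F n]
      =ᵐ[μ] fun ω => (α * (K n ω : ℝ) + θ) / ((n : ℝ) + θ)
  trans_grow : ∀ n, 1 ≤ n → ∀ r, 1 ≤ r →
    μ[Set.indicator {ω | K (n+1) ω = K n ω ∧ B r (n+1) ω + 1 = B r n ω ∧
        B (r+1) (n+1) ω = B (r+1) n ω + 1 ∧
        ∀ s, 1 ≤ s → s ≠ r → s ≠ r + 1 → B s (n+1) ω = B s n ω} (fun _ => (1:ℝ)) | F n]
      =ᵐ[μ] fun ω => (((r : ℝ) - α) * (B r n ω : ℝ)) / ((n : ℝ) + θ)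

/-- The coefficients `b_{r,i} = (-1)^(r-i) (i-α)^(r-i) / (r-i)!` for `1 ≤ i ≤ r`. -/
def bCoef (α : ℝ) (r i : ℕ) : ℝ :=
  (-1 : ℝ) ^ (r - i) * risingFactorial ((i : ℝ) - α) (r - i) / (Nat.factorial (r - i) : ℝ)

/-- Entry `Λ_{i,j} = (-1)^(i+j) (i+j)!/(i!j!) p_α(i+j)`. -/
def lambdaEntry (α : ℝ) (i j : ℕ) : ℝ :=
  (-1 : ℝ) ^ (i + j) * (Nat.factorial (i + j) : ℝ) /
    ((Nat.factorial i : ℝ) * (Nat.factorial j : ℝ)) * sibuya α (i + j)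


lemma rf_left (a : ℝ) (m : ℕ) :
    risingFactorial a (m + 1) = a * risingFactorial (a + 1) m := by
  induction m with
  | zero => simp [risingFactorial]
  | succ m ih =>
    rw [risingFactorial, ih, risingFactorial]
    push_cast
    ring

/-- generalized binomial coefficient -/
def gb (a : ℝ) (m : ℕ) : ℝ := (-1 : ℝ) ^ m * risingFactorial (-a) m / (Nat.factorial m : ℝ)

lemma gb_zero (a : ℝ) : gb a 0 = 1 := by simp [gb, risingFactorial]

lemma gb_succ (a : ℝ) (m : ℕ) : gb a (m + 1) * (m + 1) = gb a m * (a - m) := by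
  have h : (Nat.factorial m : ℝ) ≠ 0 := by positivity
  have h2 : (m : ℝ) + 1 ≠ 0 := by positivity
  simp only [gb, risingFactorial, Nat.factorial_succ]
  push_cast
  field_simp
  ring

lemma gb_succ' (a : ℝ) (m : ℕ) : gb a (m + 1) * (m + 1) = a * gb (a - 1) m := by
  have h : (Nat.factorial m : ℝ) ≠ 0 := by positivity
  have h2 : (m : ℝ) + 1 ≠ 0 := by positivity
  simp only [gb, rf_left, Nat.factorial_succ]
  have : -(a - 1) = -a + 1 := by ring
  rw [this]
  push_cast
  field_simp
  ring

lemma gb_pascal (a : ℝ) (m : ℕ) : gb a (m + 1) - gb (a - 1) m = gb (a - 1) (m + 1) := by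
  have h2 : (m : ℝ) + 1 ≠ 0 := by positivity
  have h1 := gb_succ' a m
  have h3 := gb_succ (a - 1) m
  apply mul_right_cancel₀ h2
  linear_combination h1 - h3

lemma gb_absorb (a : ℝ) (m : ℕ) : gb a m * (a - m) = a * gb (a - 1) m := by
  rw [← gb_succ, gb_succ']

lemma gb_mul (a : ℝ) (i m : ℕ) :
    gb a i * gb (a - i) m = gb a (i + m) * ((i + m).choose i : ℝ) := by
  induction m with
  | zero => simp [gb_zero]
  | succ m ih =>
    have h2 : (m : ℝ) + 1 ≠ 0 := by positivity
    have h1 := gb_succ (a - i) m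
    have h3 := gb_succ a (i + m)
    have h4 : ((i + m + 1).choose i : ℝ) * (m + 1) = ((i + m).choose i : ℝ) * (i + m + 1) := by
      have := Nat.choose_mul_succ_eq (i + m) i
      have e : i + m + 1 - i = m + 1 := by omega
      rw [e] at this
      exact_mod_cast this.symm
    apply mul_right_cancel₀ h2
    push_cast at h3
    rw [← add_assoc]
    linear_combination gb a i * h1 + (a - i - m) * ih - gb a (i+m+1) * h4 - ((i + m).choose i : ℝ) * h3

/-- truncated coefficient -/
def cH (a : ℝ) (r i : ℕ) : ℝ := if i ≤ r then gb (a - i) (r - i) else 0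

lemma cH_diff (a : ℝ) (r i : ℕ) : cH a r i - cH a r (i + 1) = cH (a - 1) r i := by
  unfold cH
  rcases lt_trichotomy i r with h | h | h
  · obtain ⟨m, rfl⟩ := Nat.exists_eq_add_of_lt h
    have e1 : i + m + 1 - i = m + 1 := by omega
    have e2 : i + m + 1 - (i + 1) = m := by omega
    rw [if_pos (by omega), if_pos (by omega), if_pos (by omega), e1, e2]
    have := gb_pascal (a - i) m
    push_cast
    have e3 : a - (i + 1) = a - i - 1 := by ring
    have e4 : a - 1 - i = a - i - 1 := by ring
    rw [e3, e4, this]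
  · subst h
    simp [gb_zero]
  · rw [if_neg (by omega), if_neg (by omega), if_neg (by omega)]; simp

lemma alt_sum (a : ℝ) (s r j : ℕ) :
    ∑ i ∈ Finset.range (r + 1), (-1 : ℝ) ^ i * (r.choose i : ℝ) * cH a s (j + i)
      = cH (a - r) s j := by
  induction r generalizing j with
  | zero => simp
  | succ r ih =>
    have h1 := ih j
    have h2 := ih (j + 1)
    have h3 := cH_diff (a - r) s j
    have e : a - ((r + 1 : ℕ) : ℝ) = a - r - 1 := by push_cast; ring
    rw [e, ← h3, ← h1, ← h2]
    rw [Finset.sum_range_succ' _ (r + 1)]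
    have h4 : ∀ i ∈ Finset.range (r + 1),
        (-1 : ℝ) ^ (i + 1) * ((r + 1).choose (i + 1) : ℝ) * cH a s (j + (i + 1))
        = (-1 : ℝ) ^ (i + 1) * (r.choose (i + 1) : ℝ) * cH a s (j + (i + 1))
          - (-1 : ℝ) ^ i * (r.choose i : ℝ) * cH a s (j + 1 + i) := by
      intro i _
      rw [Nat.choose_succ_succ, show j + 1 + i = j + (i + 1) by ring]
      push_cast
      ring
    rw [Finset.sum_congr rfl h4, Finset.sum_sub_distrib]
    have h5 := Finset.sum_range_succ'
      (fun i => (-1 : ℝ) ^ i * (r.choose i : ℝ) * cH a s (j + i)) (r + 1)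
    rw [Finset.sum_range_succ] at h5
    simp only [Nat.choose_succ_self, Nat.choose_zero_right] at h5 ⊢
    simp only [Nat.cast_zero, mul_zero, zero_mul, add_zero] at h5 ⊢
    rw [h5]
    ring

lemma gram (a : ℝ) (d r s : ℕ) (hr : r ≤ d) :
    ∑ i ∈ Finset.range (d + 1), (-1 : ℝ) ^ i * gb a i * cH a r i * cH a s i
      = gb a (r + s) * ((r + s).choose r : ℝ) := by
  rw [← gb_mul]
  have h := alt_sum a s r 0
  simp only [zero_add] at h
  have h0 : cH (a - r) s 0 = gb (a - r) s := by simp [cH]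
  rw [← h0, ← h, Finset.mul_sum]
  symm
  apply Finset.sum_subset_zero_on_sdiff (Finset.range_mono (by omega))
  · intro i hi
    simp only [Finset.mem_sdiff, Finset.mem_range] at hi
    rw [cH, if_neg (by omega)]; simp
  · intro i hi
    simp only [Finset.mem_range] at hi
    obtain ⟨m, rfl⟩ := Nat.exists_eq_add_of_le (show i ≤ r by omega)
    have := gb_mul a i m
    have e : cH a (i + m) i = gb (a - i) m := by simp [cH]
    rw [e]
    linear_combination (-(-1) ^ i * cH a s i) * this

lemma sum_gb_cH (a : ℝ) (d r : ℕ) (hr : r ≤ d) (hr1 : 1 ≤ r) :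
    ∑ i ∈ Finset.range (d + 1), (-1 : ℝ) ^ i * gb a i * cH a r i = 0 := by
  have h : ∑ i ∈ Finset.range (r + 1), (-1 : ℝ) ^ i * (r.choose i : ℝ) = 0 := by
    have := Int.alternating_sum_range_choose_of_ne (n := r) (by omega)
    exact_mod_cast this
  rw [← mul_zero (gb a r), ← h, Finset.mul_sum]
  symm
  apply Finset.sum_subset_zero_on_sdiff (Finset.range_mono (by omega))
  · intro i hi
    simp only [Finset.mem_sdiff, Finset.mem_range] at hi
    rw [cH, if_neg (by omega)]; simp
  · intro i hi
    simp only [Finset.mem_range] at hi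
    obtain ⟨m, rfl⟩ := Nat.exists_eq_add_of_le (show i ≤ r by omega)
    have := gb_mul a i m
    have e : cH a (i + m) i = gb (a - i) m := by simp [cH]
    rw [e]
    linear_combination (-(-1) ^ i) * this

lemma sibuya_eq (α : ℝ) (i : ℕ) (hi : 1 ≤ i) : sibuya α i = -((-1) ^ i * gb α i) := by
  obtain ⟨m, rfl⟩ := Nat.exists_eq_add_of_le' hi
  have : (-1 : ℝ) ^ (m + 1) * (-1 : ℝ) ^ (m + 1) = 1 := by
    rw [← mul_pow]; simp
  simp only [sibuya, gb, Nat.add_sub_cancel, rf_left]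
  rw [show -α + 1 = 1 - α by ring]
  have h : (Nat.factorial (m+1) : ℝ) ≠ 0 := by positivity
  field_simp
  linear_combination (-α * risingFactorial (1 - α) m) * this

lemma bCoef_eq (α : ℝ) (r i : ℕ) (h : i ≤ r) : bCoef α r i = cH α r i := by
  rw [cH, if_pos h, bCoef, gb]; simp

lemma cH_drift (α : ℝ) (r j : ℕ) :
    ((j : ℝ) - α) * (cH α r (j + 1) - cH α r j) = -((r : ℝ) - α) * cH α r j := by
  unfold cH
  rcases lt_trichotomy j r with h | h | h
  · obtain ⟨m, rfl⟩ := Nat.exists_eq_add_of_lt h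
    have e1 : j + m + 1 - j = m + 1 := by omega
    have e2 : j + m + 1 - (j + 1) = m := by omega
    rw [if_pos (by omega), if_pos (by omega), e1, e2]
    have := gb_succ' (α - j) m
    push_cast
    have e3 : α - (j + 1) = α - j - 1 := by ring
    rw [e3]
    linear_combination this
  · subst h
    simp [gb_zero]
  · rw [if_neg (by omega), if_neg (by omega)]; simp

lemma rf_pos (a : ℝ) (ha : 0 < a) (m : ℕ) : 0 < risingFactorial a m := by
  induction m with
  | zero => simp [risingFactorial]
  | succ m ih => rw [risingFactorial]; positivity

lemma sibuya_pos (α : ℝ) (h0 : 0 < α) (h1 : α < 1) (i : ℕ) : 0 < sibuya α i := by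
  have := rf_pos (1 - α) (by linarith) (i - 1)
  unfold sibuya
  positivity

lemma sibuya_sum (α : ℝ) (d : ℕ) :
    ∑ i ∈ Finset.Icc 1 d, sibuya α i = 1 - risingFactorial (1 - α) d / (Nat.factorial d : ℝ) := by
  induction d with
  | zero => simp [risingFactorial]
  | succ d ih =>
    rw [Finset.sum_Icc_succ_top (by omega), ih, sibuya, risingFactorial, Nat.factorial_succ]
    have h : (Nat.factorial d : ℝ) ≠ 0 := by positivity
    push_cast
    field_simp
    ring

lemma sibuya_sum_le (α : ℝ) (h1 : α < 1) (d : ℕ) :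
    ∑ i ∈ Finset.Icc 1 d, sibuya α i ≤ 1 := by
  rw [sibuya_sum]
  have := rf_pos (1 - α) (by linarith) d
  have h : 0 ≤ risingFactorial (1 - α) d / (Nat.factorial d : ℝ) := by positivity
  linarith

lemma lambda_eq (α : ℝ) (r s : ℕ) (hr : 1 ≤ r) :
    lambdaEntry α r s = -(gb α (r + s) * ((r + s).choose r : ℝ)) := by
  rw [lambdaEntry, sibuya_eq α (r + s) (by omega)]
  have h : (Nat.factorial r : ℝ) ≠ 0 := by positivity
  have h' : (Nat.factorial s : ℝ) ≠ 0 := by positivity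
  have h2 : ((r + s).choose r : ℝ) * Nat.factorial r * Nat.factorial s = Nat.factorial (r + s) := by
    have := Nat.add_choose_mul_factorial_mul_factorial r s
    rw [← Nat.choose_symm_add] at this
    exact_mod_cast this
  have : (-1 : ℝ) ^ (r + s) * (-1 : ℝ) ^ (r + s) = 1 := by
    rw [← mul_pow]; simp
  rw [← h2]
  field_simp
  linear_combination (- gb α (r + s) * ((r + s).choose r : ℝ)) * this

lemma sum_range_split (d : ℕ) (f : ℕ → ℝ) :
    ∑ i ∈ Finset.range (d + 1), f i = f 0 + ∑ i ∈ Finset.Icc 1 d, f i := by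
  rw [Finset.range_eq_Ico, Finset.sum_eq_sum_Ico_succ_bot (by omega)]
  rfl

/-- Λ as a covariance -/
lemma lambda_cov (α : ℝ) (d r s : ℕ) (hr1 : 1 ≤ r) (hr : r ≤ d) :
    lambdaEntry α r s = ∑ i ∈ Finset.Icc 1 d, sibuya α i * cH α r i * cH α s i
      - cH α r 0 * cH α s 0 := by
  rw [lambda_eq α r s hr1, ← gram α d r s hr, sum_range_split, gb_zero]
  have : ∑ i ∈ Finset.Icc 1 d, sibuya α i * cH α r i * cH α s i
      = - ∑ i ∈ Finset.Icc 1 d, (-1 : ℝ) ^ i * gb α i * cH α r i * cH α s i := by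
    rw [← Finset.sum_neg_distrib]
    apply Finset.sum_congr rfl
    intro i hi
    rw [sibuya_eq α i (Finset.mem_Icc.1 hi).1]; ring
  rw [this]; simp; ring

lemma mean_id (α : ℝ) (d r : ℕ) (hr1 : 1 ≤ r) (hr : r ≤ d) :
    ∑ i ∈ Finset.Icc 1 d, sibuya α i * cH α r i = cH α r 0 := by
  have h := sum_gb_cH α d r hr hr1
  rw [sum_range_split, gb_zero] at h
  have : ∑ i ∈ Finset.Icc 1 d, sibuya α i * cH α r i
      = - ∑ i ∈ Finset.Icc 1 d, (-1 : ℝ) ^ i * gb α i * cH α r i := by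
    rw [← Finset.sum_neg_distrib]
    apply Finset.sum_congr rfl
    intro i hi
    rw [sibuya_eq α i (Finset.mem_Icc.1 hi).1]; ring
  rw [this]; simp at h; linarith

/-- jump covariance identity -/
lemma sigma_id (α : ℝ) (d r s : ℕ) (hr1 : 1 ≤ r) (hr : r ≤ d) :
    α * (cH α r 1 - cH α r 0) * (cH α s 1 - cH α s 0)
      + ∑ j ∈ Finset.Icc 1 d, ((j : ℝ) - α) * sibuya α j * (cH α r (j + 1) - cH α r j)
          * (cH α s (j + 1) - cH α s j)
      = ((r : ℝ) + s - α) * lambdaEntry α r s := by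
  have h := gram (α - 1) d r s hr
  have h2 := gb_absorb α (r + s)
  rw [sum_range_split, gb_zero] at h
  have e : ∀ r j, cH α r (j + 1) - cH α r j = - cH (α - 1) r j := by
    intro r j; rw [← cH_diff]; ring
  have e1 := fun r => e r 0
  simp only [zero_add] at e1
  simp only [e1, e, lambda_eq α r s hr1]
  have : ∑ j ∈ Finset.Icc 1 d, ((j : ℝ) - α) * sibuya α j * (-cH (α - 1) r j) * (-cH (α - 1) s j)
      = α * ∑ i ∈ Finset.Icc 1 d, (-1 : ℝ) ^ i * gb (α - 1) i * cH (α - 1) r i * cH (α - 1) s i := by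
    rw [Finset.mul_sum]
    apply Finset.sum_congr rfl
    intro i hi
    rw [sibuya_eq α i (Finset.mem_Icc.1 hi).1]
    have := gb_absorb α i
    linear_combination ((-1) ^ i * cH (α - 1) r i * cH (α - 1) s i) * this
  rw [this]
  push_cast at h2
  linear_combination α * h - ((r + s).choose r : ℝ) * h2



lemma meas_comp {Ω' E : Type*} {m : MeasurableSpace Ω'} [MeasurableSpace E] {g : ℕ → ℝ → E}
    (hg : ∀ k, Measurable (g k)) {k : Ω' → ℕ} {z : Ω' → ℝ} (hk : Measurable k)
    (hz : Measurable z) : Measurable fun ω => g (k ω) (z ω) := by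
  have : Measurable (fun p : ℕ × ℝ => g p.1 p.2) := measurable_from_prod_countable_right hg
  exact this.comp (hk.prodMk hz)

lemma int_event {Ω E : Type*} [NormedAddCommGroup E] [NormedSpace ℝ E] [CompleteSpace E]
    {m mΩ : MeasurableSpace Ω} (hm : m ≤ mΩ) {μ : Measure Ω} [IsProbabilityMeasure μ]
    {A : Set Ω} (hA : MeasurableSet A) {p : Ω → ℝ}
    (hp : μ[A.indicator (fun _ => (1 : ℝ)) | m] =ᵐ[μ] p)
    {h : Ω → E} (hh : StronglyMeasurable[m] h) {C : ℝ} (hC : ∀ᵐ ω ∂μ, ‖h ω‖ ≤ C) :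
    Integrable (fun ω => A.indicator (fun _ => (1 : ℝ)) ω • h ω) μ ∧
    Integrable (fun ω => p ω • h ω) μ ∧
    ∫ ω, A.indicator (fun _ => (1 : ℝ)) ω • h ω ∂μ = ∫ ω, p ω • h ω ∂μ := by
  have hi : Integrable (A.indicator (fun _ => (1 : ℝ))) μ :=
    (integrable_const (1 : ℝ)).indicator hA
  have h1 : Integrable (A.indicator (fun _ => (1 : ℝ)) • h) μ := by
    refine Integrable.of_bound (C := C)
      (hi.aestronglyMeasurable.smul (hh.mono hm).aestronglyMeasurable) ?_
    filter_upwards [hC] with ω hω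
    rw [Pi.smul_apply', norm_smul]
    have h0 : 0 ≤ ‖h ω‖ := norm_nonneg _
    by_cases hh : ω ∈ A
    · simp [hh, hω]
    · simp [hh]; linarith
  have h2 := condExp_smul_of_aestronglyMeasurable_right hi h1 hh.aestronglyMeasurable
  have h3 : μ[A.indicator (fun _ => (1 : ℝ)) • h | m] =ᵐ[μ] fun ω => p ω • h ω := by
    filter_upwards [h2, hp] with ω a b
    rw [a, Pi.smul_apply', b]
  refine ⟨h1, integrable_condExp.congr h3, ?_⟩
  rw [← integral_congr_ae h3, integral_condExp hm]
  rfl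

/-- event: new block -/
def newEv {Ω : Type*} (K : ℕ → Ω → ℕ) (B : ℕ → ℕ → Ω → ℕ) (n : ℕ) : Set Ω :=
  {ω | K (n+1) ω = K n ω + 1 ∧ B 1 (n+1) ω = B 1 n ω + 1 ∧
        ∀ s, 2 ≤ s → B s (n+1) ω = B s n ω}

/-- event: a block of size r grows -/
def growEv {Ω : Type*} (K : ℕ → Ω → ℕ) (B : ℕ → ℕ → Ω → ℕ) (n r : ℕ) : Set Ω :=
  {ω | K (n+1) ω = K n ω ∧ B r (n+1) ω + 1 = B r n ω ∧
        B (r+1) (n+1) ω = B (r+1) n ω + 1 ∧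
        ∀ s, 1 ≤ s → s ≠ r → s ≠ r + 1 → B s (n+1) ω = B s n ω}

lemma disj_new {Ω : Type*} {K : ℕ → Ω → ℕ} {B : ℕ → ℕ → Ω → ℕ} {n r : ℕ} {ω : Ω}
    (h1 : ω ∈ newEv K B n) (h2 : ω ∈ growEv K B n r) : False := by
  have := h1.1; have := h2.1; omega

lemma disj_grow {Ω : Type*} {K : ℕ → Ω → ℕ} {B : ℕ → ℕ → Ω → ℕ} {n r s : ℕ} {ω : Ω}
    (hr : 1 ≤ r) (h1 : ω ∈ growEv K B n r) (h2 : ω ∈ growEv K B n s) : r = s := by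
  by_contra hne
  have h := h1.2.1
  by_cases e : r = s + 1
  · have := h2.2.2.1
    rw [← e] at this; omega
  · have := h2.2.2.2 r hr hne e
    omega

/-- the linear statistic -/
def zz {Ω : Type*} (β : ℕ → ℝ) (d : ℕ) (K : ℕ → Ω → ℕ) (B : ℕ → ℕ → Ω → ℕ) (n : ℕ) (ω : Ω) : ℝ :=
  ∑ i ∈ Finset.Icc 1 d, β i * (B i n ω : ℝ) - β 0 * (K n ω : ℝ)

/-- bound constant -/
def bb (β : ℕ → ℝ) (d : ℕ) : ℝ := ∑ i ∈ Finset.Icc 1 d, |β i| + |β 0|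

lemma bb_nonneg (β : ℕ → ℝ) (d : ℕ) : 0 ≤ bb β d := by unfold bb; positivity

section trans
variable {α θ : ℝ} {Ω : Type*} {mΩ : MeasurableSpace Ω} {μ : Measure Ω} {F : Filtration ℕ mΩ}
    {K : ℕ → Ω → ℕ} {B : ℕ → ℕ → Ω → ℕ}

lemma zz_new {β : ℕ → ℝ} {d n : ℕ} (hd : 1 ≤ d) {ω : Ω} (h : ω ∈ newEv K B n) :
    zz β d K B (n + 1) ω = zz β d K B n ω + (β 1 - β 0) := by
  obtain ⟨h1, h2, h3⟩ := h
  unfold zz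
  rw [h1, ← Finset.add_sum_Ioc_eq_sum_Icc hd, ← Finset.add_sum_Ioc_eq_sum_Icc hd, h2]
  have : ∑ i ∈ Finset.Ioc 1 d, β i * (B i (n+1) ω : ℝ) = ∑ i ∈ Finset.Ioc 1 d, β i * (B i n ω : ℝ) := by
    apply Finset.sum_congr rfl
    intro i hi
    rw [h3 i (Finset.mem_Ioc.1 hi).1]
  rw [this]
  push_cast
  ring

lemma zz_grow {β : ℕ → ℝ} {d n r : ℕ} (hβ : β (d + 1) = 0) (hr : 1 ≤ r) {ω : Ω}
    (h : ω ∈ growEv K B n r) :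
    zz β d K B (n + 1) ω = zz β d K B n ω + (if r ≤ d then β (r + 1) - β r else 0) := by
  obtain ⟨h1, h2, h3, h4⟩ := h
  unfold zz
  rw [h1]
  have e : ∀ i ∈ Finset.Icc 1 d, β i * (B i (n+1) ω : ℝ) = β i * (B i n ω : ℝ) +
      ((if i = r + 1 then β (r + 1) else 0) - (if i = r then β r else 0)) := by
    intro i hi
    have hi1 := (Finset.mem_Icc.1 hi).1
    by_cases e1 : i = r
    · subst e1
      have : (B i n ω : ℝ) = B i (n+1) ω + 1 := by rw [← h2]; push_cast; ring
      rw [this]; simp; ring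
    · by_cases e2 : i = r + 1
      · subst e2
        rw [h3]; simp; ring
      · rw [h4 i hi1 e1 e2]; simp [e1, e2]
  rw [Finset.sum_congr rfl e, Finset.sum_add_distrib, Finset.sum_sub_distrib]
  simp only [Finset.sum_ite_eq', Finset.mem_Icc]
  by_cases hrd : r ≤ d
  · by_cases hrd' : r + 1 ≤ d
    · simp [hrd, hrd', hr]; ring
    · have : r = d := by omega
      subst this
      simp [hr, hβ]; ring
  · have : ¬ (r + 1 ≤ d) := by omega
    simp [hrd, this]

variable (hEP : IsEwensPitman α θ μ F K B)
include hEP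

lemma ep_basic (n : ℕ) (hn : 1 ≤ n) :
    ∀ᵐ ω ∂μ, 1 ≤ K n ω ∧ K n ω ≤ n ∧ ∀ i, 1 ≤ i → B i n ω ≤ K n ω := by
  have h0 : ∀ᵐ ω ∂μ, ∀ r, n < r → B r n ω = 0 := by
    rw [ae_all_iff]; intro r
    by_cases h : n < r
    · filter_upwards [hEP.B_eq_zero r n h] with ω hω _ using hω
    · filter_upwards with ω h'; exact absurd h' h
  filter_upwards [h0, hEP.sum_blocks n hn, hEP.sum_sizes n hn] with ω h0 h1 h2
  refine ⟨?_, ?_, ?_⟩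
  · by_contra hK
    have hK : ∑ r ∈ Finset.Icc 1 n, B r n ω = 0 := by omega
    rw [Finset.sum_eq_zero_iff] at hK
    have : ∑ r ∈ Finset.Icc 1 n, r * B r n ω = 0 := by
      apply Finset.sum_eq_zero
      intro i hi; rw [hK i hi]; simp
    omega
  · rw [h1]; conv_rhs => rw [h2]
    apply Finset.sum_le_sum
    intro i hi
    exact Nat.le_mul_of_pos_left _ (Finset.mem_Icc.1 hi).1
  · intro i hi
    by_cases hin : i ≤ n
    · rw [h1]
      exact Finset.single_le_sum (f := fun i => B i n ω) (fun _ _ => Nat.zero_le _)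
        (Finset.mem_Icc.2 ⟨hi, hin⟩)
    · rw [h0 i (by omega)]; omega

lemma zz_bound (β : ℕ → ℝ) (d n : ℕ) (hn : 1 ≤ n) :
    ∀ᵐ ω ∂μ, |zz β d K B n ω| ≤ bb β d * K n ω := by
  filter_upwards [ep_basic hEP n hn] with ω h
  unfold zz bb
  rw [add_mul, Finset.sum_mul]
  refine (abs_sub _ _).trans (add_le_add ((Finset.abs_sum_le_sum_abs _ _).trans ?_) ?_)
  · apply Finset.sum_le_sum
    intro i hi
    rw [abs_mul, Nat.abs_cast]
    gcongr
    exact_mod_cast h.2.2 i (Finset.mem_Icc.1 hi).1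
  · rw [abs_mul, Nat.abs_cast]

lemma meas_zz (β : ℕ → ℝ) (d n : ℕ) : Measurable[F n] (zz β d K B n) := by
  have h1 : ∀ i, Measurable[F n] (fun ω => (B i n ω : ℝ)) := fun i =>
    (measurable_from_nat (f := fun k : ℕ => (k : ℝ))).comp (hEP.meas_B i n)
  have h2 : Measurable[F n] (fun ω => (K n ω : ℝ)) :=
    (measurable_from_nat (f := fun k : ℕ => (k : ℝ))).comp (hEP.meas_K n)
  unfold zz
  exact (Finset.measurable_sum _ fun i _ => (h1 i).const_mul _).sub (h2.const_mul _)

lemma meas_newEv (n : ℕ) : MeasurableSet (newEv K B n) := by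
  have hK : ∀ n, Measurable (K n) := fun n => (hEP.meas_K n).mono (F.le n) le_rfl
  have hB : ∀ r n, Measurable (B r n) := fun r n => (hEP.meas_B r n).mono (F.le n) le_rfl
  unfold newEv
  refine (measurableSet_eq_fun (hK _) ((hK _).add_const 1)).inter
    ((measurableSet_eq_fun (hB _ _) ((hB _ _).add_const 1)).inter ?_)
  change MeasurableSet {ω | ∀ s, 2 ≤ s → B s (n+1) ω = B s n ω}
  simp only [Set.ofPred_forall]
  exact MeasurableSet.iInter fun s => MeasurableSet.iInter fun _ =>
    measurableSet_eq_fun (hB _ _) (hB _ _)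

lemma meas_growEv (n r : ℕ) : MeasurableSet (growEv K B n r) := by
  have hK : ∀ n, Measurable (K n) := fun n => (hEP.meas_K n).mono (F.le n) le_rfl
  have hB : ∀ r n, Measurable (B r n) := fun r n => (hEP.meas_B r n).mono (F.le n) le_rfl
  unfold growEv
  refine (measurableSet_eq_fun (hK _) (hK _)).inter
    ((measurableSet_eq_fun ((hB _ _).add_const 1) (hB _ _)).inter
    ((measurableSet_eq_fun (hB _ _) ((hB _ _).add_const 1)).inter ?_))
  change MeasurableSet {ω | ∀ s, 1 ≤ s → s ≠ r → s ≠ r + 1 → B s (n+1) ω = B s n ω}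
  simp only [Set.ofPred_forall]
  exact MeasurableSet.iInter fun s => MeasurableSet.iInter fun _ => MeasurableSet.iInter fun _ =>
    MeasurableSet.iInter fun _ => measurableSet_eq_fun (hB _ _) (hB _ _)

lemma cover (hα1 : α < 1) (hθ : 0 < α + θ) (n : ℕ) (hn : 1 ≤ n) :
    ∀ᵐ ω ∂μ, ω ∈ newEv K B n ∨ ∃ r, 1 ≤ r ∧ ω ∈ growEv K B n r := by
  have := hEP.prob
  have hN : (0 : ℝ) < n + θ := by
    have : (1 : ℝ) ≤ n := by exact_mod_cast hn
    linarith
  have key1 := int_event (E := ℝ) (F.le n) (meas_newEv hEP n) (hEP.trans_new n hn)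
    (h := fun _ => (1 : ℝ)) stronglyMeasurable_const (C := 1) (by simp)
  have key2 := fun r hr => int_event (E := ℝ) (F.le n) (meas_growEv hEP n r)
    (hEP.trans_grow n hn r hr)
    (h := fun _ => (1 : ℝ)) stronglyMeasurable_const (C := 1) (by simp)
  simp only [smul_eq_mul, mul_one] at key1 key2
  let f : Ω → ℝ := fun ω => (newEv K B n).indicator (fun _ => (1 : ℝ)) ω +
    ∑ r ∈ Finset.Icc 1 n, (growEv K B n r).indicator (fun _ => (1 : ℝ)) ω
  have hf : Integrable f μ := key1.1.add
    (integrable_finsetSum _ fun r hr => (key2 r (Finset.mem_Icc.1 hr).1).1)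
  have hint : ∫ ω, f ω ∂μ = 1 := by
    simp only [f]
    rw [integral_add key1.1
      (integrable_finsetSum _ fun r hr => (key2 r (Finset.mem_Icc.1 hr).1).1),
      integral_finsetSum _ (fun r hr => (key2 r (Finset.mem_Icc.1 hr).1).1), key1.2.2,
      Finset.sum_congr rfl (fun r hr => (key2 r (Finset.mem_Icc.1 hr).1).2.2),
      ← integral_finsetSum _ (fun r hr => (key2 r (Finset.mem_Icc.1 hr).1).2.1),
      ← integral_add key1.2.1
      (integrable_finsetSum _ fun r hr => (key2 r (Finset.mem_Icc.1 hr).1).2.1)]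
    have : ∀ᵐ ω ∂μ, (α * (K n ω : ℝ) + θ) / ((n : ℝ) + θ) +
        ∑ r ∈ Finset.Icc 1 n, (((r : ℝ) - α) * (B r n ω : ℝ)) / ((n : ℝ) + θ) = 1 := by
      filter_upwards [hEP.sum_blocks n hn, hEP.sum_sizes n hn] with ω h1 h2
      have h2' : (n : ℝ) = ∑ r ∈ Finset.Icc 1 n, (r : ℝ) * B r n ω := by exact_mod_cast h2
      have h1' : (K n ω : ℝ) = ∑ r ∈ Finset.Icc 1 n, (B r n ω : ℝ) := by exact_mod_cast h1
      rw [← Finset.sum_div, ← add_div, div_eq_one_iff_eq hN.ne']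
      simp only [sub_mul]
      rw [Finset.sum_sub_distrib, ← Finset.mul_sum, ← h1', ← h2']
      ring
    rw [integral_congr_ae this]; simp
  have hle : ∀ ω, f ω ≤ 1 := by
    intro ω
    by_cases h : ω ∈ newEv K B n
    · have : ∑ r ∈ Finset.Icc 1 n, (growEv K B n r).indicator (fun _ => (1 : ℝ)) ω = 0 := by
        apply Finset.sum_eq_zero
        intro r hr
        exact Set.indicator_of_notMem (fun h' => disj_new h h') _
      simp only [f, this]; simp [h]
    · by_cases h' : ∃ r ∈ Finset.Icc 1 n, ω ∈ growEv K B n r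
      · obtain ⟨r, hr, hω⟩ := h'
        simp only [f]
        rw [Finset.sum_eq_single_of_mem r hr]
        · simp [h, hω]
        · intro s hs hsr
          exact Set.indicator_of_notMem
            (fun h' => hsr (disj_grow (Finset.mem_Icc.1 hs).1 h' hω)) _
      · push Not at h'
        have : ∑ r ∈ Finset.Icc 1 n, (growEv K B n r).indicator (fun _ => (1 : ℝ)) ω = 0 := by
          apply Finset.sum_eq_zero
          intro r hr
          exact Set.indicator_of_notMem (h' r hr) _
        simp only [f, this]; simp [h]
  have h0 : (fun ω => 1 - f ω) =ᵐ[μ] 0 := by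
    rw [← integral_eq_zero_iff_of_nonneg (fun ω => by simpa using hle ω)
      (show Integrable (fun ω => 1 - f ω) μ from (integrable_const _).sub hf)]
    rw [integral_sub (integrable_const _) hf, hint]; simp
  filter_upwards [h0] with ω hω
  by_contra hcon
  push Not at hcon
  have : f ω = 0 := by
    simp only [f]
    rw [Finset.sum_eq_zero]
    · simp [hcon.1]
    · intro r hr
      exact Set.indicator_of_notMem (hcon.2 r (Finset.mem_Icc.1 hr).1) _
  simp [this] at hω

lemma transition {E : Type*} [NormedAddCommGroup E] [NormedSpace ℝ E] [CompleteSpace E]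
    [MeasurableSpace E] [BorelSpace E] [SecondCountableTopology E]
    (hα1 : α < 1) (hθ : 0 < α + θ) (n : ℕ) (hn : 1 ≤ n)
    {d : ℕ} (hd : 1 ≤ d) {β : ℕ → ℝ} (hβ : β (d + 1) = 0)
    {g : ℕ → ℝ → E} (hg : ∀ k, Measurable (g k)) (hb : ∀ k z, ‖g k z‖ ≤ 1 + z ^ 2) :
    (∀ n, 1 ≤ n → Integrable (fun ω => g (K n ω) (zz β d K B n ω)) μ) ∧
    Integrable (fun ω => ((α * (K n ω : ℝ) + θ) / ((n : ℝ) + θ)) •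
        (g (K n ω + 1) (zz β d K B n ω + (β 1 - β 0)) - g (K n ω) (zz β d K B n ω)) +
      ∑ j ∈ Finset.Icc 1 d, ((((j : ℝ) - α) * (B j n ω : ℝ)) / ((n : ℝ) + θ)) •
        (g (K n ω) (zz β d K B n ω + (β (j + 1) - β j)) - g (K n ω) (zz β d K B n ω))) μ ∧
    ∫ ω, g (K (n + 1) ω) (zz β d K B (n + 1) ω) ∂μ =
      ∫ ω, g (K n ω) (zz β d K B n ω) ∂μ +
      ∫ ω, (((α * (K n ω : ℝ) + θ) / ((n : ℝ) + θ)) •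
        (g (K n ω + 1) (zz β d K B n ω + (β 1 - β 0)) - g (K n ω) (zz β d K B n ω)) +
      ∑ j ∈ Finset.Icc 1 d, ((((j : ℝ) - α) * (B j n ω : ℝ)) / ((n : ℝ) + θ)) •
        (g (K n ω) (zz β d K B n ω + (β (j + 1) - β j)) - g (K n ω) (zz β d K B n ω))) ∂μ := by
  have := hEP.prob
  have hmK := hEP.meas_K n
  have hmz := meas_zz hEP β d n
  have hmg : ∀ (l : ℕ) (u : ℝ), Measurable[F n] (fun ω => g (K n ω + l) (zz β d K B n ω + u)) := by
    intro l u
    exact meas_comp (Ω' := Ω) hg (hmK.add_const l) (hmz.add_const u)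
  have hbd : ∀ (n l : ℕ) (u : ℝ), 1 ≤ n → ∀ᵐ ω ∂μ, ‖g (K n ω + l) (zz β d K B n ω + u)‖
      ≤ 1 + (bb β d * n + |u|) ^ 2 := by
    intro n l u hn
    filter_upwards [zz_bound hEP β d n hn, ep_basic hEP n hn] with ω h1 h2
    refine (hb _ _).trans ?_
    gcongr 1 + ?_
    rw [← sq_abs]
    have h3 : (K n ω : ℝ) ≤ n := by exact_mod_cast h2.2.1
    have h4 := bb_nonneg β d
    gcongr
    refine (abs_add_le _ _).trans ?_
    gcongr
    exact h1.trans (by gcongr)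
  have hI : ∀ n, 1 ≤ n → Integrable (fun ω => g (K n ω) (zz β d K B n ω)) μ := by
    intro n hn
    have h1 := hbd n 0 0 hn
    simp only [add_zero] at h1
    have h2 : Measurable[F n] (fun ω => g (K n ω) (zz β d K B n ω)) :=
      meas_comp (Ω' := Ω) hg (hEP.meas_K n) (meas_zz hEP β d n)
    exact Integrable.of_bound (h2.mono (F.le n) le_rfl).aestronglyMeasurable _ h1
  refine ⟨hI, ?_⟩
  let h0 : Ω → E := fun ω =>
    g (K n ω + 1) (zz β d K B n ω + (β 1 - β 0)) - g (K n ω) (zz β d K B n ω)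
  let h : ℕ → Ω → E := fun j ω =>
    g (K n ω) (zz β d K B n ω + (β (j + 1) - β j)) - g (K n ω) (zz β d K B n ω)
  have hm00 : Measurable[F n] (fun ω => g (K n ω) (zz β d K B n ω)) := by simpa using hmg 0 0
  have hm0 : Measurable[F n] h0 := (hmg 1 (β 1 - β 0)).sub hm00
  have hmj : ∀ j, Measurable[F n] (h j) := by
    intro j
    have := hmg 0 (β (j + 1) - β j)
    simp only [add_zero] at this
    exact this.sub hm00
  have hb00 := hbd n 0 0 hn
  simp only [add_zero] at hb00
  have key1 := int_event (E := E) (F.le n) (meas_newEv hEP n) (hEP.trans_new n hn)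
    (h := h0) hm0.stronglyMeasurable
    (by filter_upwards [hbd n 1 (β 1 - β 0) hn, hb00] with ω a b
        exact (norm_sub_le _ _).trans (add_le_add a b))
  have key2 := fun r hr => int_event (E := E) (F.le n) (meas_growEv hEP n r)
    (hEP.trans_grow n hn r hr)
    (h := h r) (hmj r).stronglyMeasurable
    (by have := hbd n 0 (β (r + 1) - β r) hn
        simp only [add_zero] at this
        filter_upwards [this, hb00] with ω a b
        exact (norm_sub_le _ _).trans (add_le_add a b))
  have hJ1 := integrable_finsetSum (Finset.Icc 1 d)
    (fun r hr => (key2 r (Finset.mem_Icc.1 hr).1).1)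
  have hJ2 := integrable_finsetSum (Finset.Icc 1 d)
    (fun r hr => (key2 r (Finset.mem_Icc.1 hr).1).2.1)
  refine ⟨key1.2.1.add hJ2, ?_⟩
  have hae : (fun ω => g (K (n + 1) ω) (zz β d K B (n + 1) ω)) =ᵐ[μ]
      fun ω => g (K n ω) (zz β d K B n ω) +
        ((newEv K B n).indicator (fun _ => (1 : ℝ)) ω • h0 ω +
         ∑ r ∈ Finset.Icc 1 d, (growEv K B n r).indicator (fun _ => (1 : ℝ)) ω • h r ω) := by
    filter_upwards [cover hEP hα1 hθ n hn] with ω hω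
    rcases hω with hω | ⟨r, hr, hω⟩
    · rw [Finset.sum_eq_zero, zz_new hd hω, hω.1]
      · simp [hω, h0]
      · intro r hr
        rw [Set.indicator_of_notMem (fun h' => disj_new hω h')]; simp
    · rw [Set.indicator_of_notMem (fun h' => disj_new h' hω), zz_grow hβ hr hω, hω.1]
      by_cases hrd : r ≤ d
      · rw [Finset.sum_eq_single_of_mem r (Finset.mem_Icc.2 ⟨hr, hrd⟩)]
        · simp [hω, h, hrd]
        · intro s hs hsr
          rw [Set.indicator_of_notMem
            (fun h' => hsr (disj_grow (Finset.mem_Icc.1 hs).1 h' hω))]; simp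
      · rw [Finset.sum_eq_zero]
        · simp [hrd]
        · intro s hs
          rw [Set.indicator_of_notMem
            (fun h' => hrd ((disj_grow (Finset.mem_Icc.1 hs).1 h' hω) ▸ (Finset.mem_Icc.1 hs).2))]
          simp
  rw [integral_congr_ae hae, integral_add (hI n hn) (show Integrable (fun ω =>
      (newEv K B n).indicator (fun _ => (1 : ℝ)) ω • h0 ω +
      ∑ r ∈ Finset.Icc 1 d, (growEv K B n r).indicator (fun _ => (1 : ℝ)) ω • h r ω) μ from
      key1.1.add hJ1), integral_add key1.1 hJ1,
    integral_finsetSum _ (fun r hr => (key2 r (Finset.mem_Icc.1 hr).1).1), key1.2.2,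
    Finset.sum_congr rfl (fun r hr => (key2 r (Finset.mem_Icc.1 hr).1).2.2),
    ← integral_finsetSum _ (fun r hr => (key2 r (Finset.mem_Icc.1 hr).1).2.1),
    ← integral_add key1.2.1 hJ2]

end trans



lemma gron (θ c : ℝ) (hc : 0 < c) (x ε : ℕ → ℝ) (hx : ∀ n, 0 ≤ x n)
    (hε : Tendsto ε atTop (𝓝 0))
    (h : ∀ᶠ n : ℕ in atTop, x (n + 1) ≤ (1 - c / (n + θ)) * x n + ε n / (n + θ)) :
    Tendsto x atTop (𝓝 0) := by
  have hN : Tendsto (fun n : ℕ => (n : ℝ) + θ) atTop atTop :=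
    tendsto_atTop_add_const_right _ _ tendsto_natCast_atTop_atTop
  have hH : Tendsto (fun n => ∑ k ∈ Finset.range n, 1 / |(k : ℝ) + θ| ^ (1 : ℝ)) atTop atTop := by
    rw [← not_summable_iff_tendsto_nat_atTop_of_nonneg (fun n => by positivity)]
    rw [Real.summable_one_div_nat_add_rpow]
    exact lt_irrefl _
  simp only [Real.rpow_one] at hH
  set H : ℕ → ℝ := fun n => ∑ k ∈ Finset.range n, 1 / |(k : ℝ) + θ| with hHdef
  rw [Metric.tendsto_atTop]
  intro δ hδ
  have hev : ∀ᶠ n : ℕ in atTop, max (x (n + 1) - δ / 2) 0 ≤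
      (1 - c / (n + θ)) * max (x n - δ / 2) 0 ∧ 0 < (n : ℝ) + θ := by
    have h1 : ∀ᶠ n in atTop, ε n < c * (δ / 2) := hε.eventually_lt_const (by positivity)
    filter_upwards [h, h1, hN.eventually_gt_atTop c] with n h1 h2 h3
    have hNp : 0 < (n : ℝ) + θ := hc.trans h3
    have h4 : 0 ≤ 1 - c / (n + θ) := by
      rw [sub_nonneg, div_le_one hNp]; exact h3.le
    refine ⟨?_, hNp⟩
    apply max_le
    · have h5 : ε n / (n + θ) ≤ c * (δ / 2) / (n + θ) := by gcongr
      calc x (n + 1) - δ / 2 ≤ (1 - c / (n + θ)) * (x n - δ / 2) := by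
            have : c * (δ / 2) / (n + θ) = c / (n + θ) * (δ / 2) := by ring
            rw [this] at h5
            linarith
        _ ≤ _ := by gcongr; exact le_max_left _ _
    · exact mul_nonneg h4 (le_max_right _ _)
  obtain ⟨m, hm⟩ := eventually_atTop.1 hev
  set y : ℕ → ℝ := fun n => max (x n - δ / 2) 0 with hy
  have hz : ∀ n, m ≤ n → y n * Real.exp (c * H n) ≤ y m * Real.exp (c * H m) := by
    intro n hn
    induction n, hn using Nat.le_induction with
    | base => exact le_rfl
    | succ n hn ih =>
      refine le_trans ?_ ih
      obtain ⟨h1, h2⟩ := hm n hn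
      have e : H (n + 1) = H n + 1 / (n + θ) := by
        simp only [hHdef]
        rw [Finset.sum_range_succ, abs_of_pos h2]
      rw [e, mul_add, Real.exp_add]
      have hyn : 0 ≤ y n := le_max_right _ _
      have h3 : (1 - c / (n + θ)) * Real.exp (c * (1 / (n + θ))) ≤ 1 := by
        have := Real.add_one_le_exp (-(c / (n + θ)))
        calc (1 - c / (n + θ)) * Real.exp (c * (1 / (n + θ)))
            ≤ Real.exp (-(c / (n + θ))) * Real.exp (c * (1 / (n + θ))) := by
              gcongr; linarith
          _ = 1 := by rw [← Real.exp_add]; simp [div_eq_mul_inv]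
      calc y (n + 1) * (Real.exp (c * H n) * Real.exp (c * (1 / (n + θ))))
          ≤ ((1 - c / (n + θ)) * y n) * (Real.exp (c * H n) * Real.exp (c * (1 / (n + θ)))) := by
            gcongr
        _ = (y n * Real.exp (c * H n)) * ((1 - c / (n + θ)) * Real.exp (c * (1 / (n + θ)))) := by ring
        _ ≤ (y n * Real.exp (c * H n)) * 1 := by gcongr
        _ = _ := by ring
  have hlim : Tendsto (fun n => y m * Real.exp (c * H m) * Real.exp (-(c * H n))) atTop (𝓝 0) := by
    have : Tendsto (fun n => Real.exp (-(c * H n))) atTop (𝓝 0) :=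
      Real.tendsto_exp_neg_atTop_nhds_zero.comp (hH.const_mul_atTop hc)
    simpa using this.const_mul (y m * Real.exp (c * H m))
  have h6 : ∀ᶠ n in atTop, y m * Real.exp (c * H m) * Real.exp (-(c * H n)) < δ / 2 :=
    hlim.eventually_lt_const (by positivity)
  obtain ⟨m', hm'⟩ := eventually_atTop.1 h6
  refine ⟨max m m', fun n hn => ?_⟩
  have h7 := hm' n (le_of_max_le_right hn)
  have h8 := hz n (le_of_max_le_left hn)
  have h9 : y n ≤ y m * Real.exp (c * H m) * Real.exp (-(c * H n)) := by
    calc y n = y n * Real.exp (c * H n) * Real.exp (-(c * H n)) := by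
          rw [mul_assoc, ← Real.exp_add]; simp
      _ ≤ _ := by gcongr
  have h10 : x n - δ / 2 ≤ y n := le_max_left _ _
  rw [Real.dist_eq, sub_zero, abs_of_nonneg (hx n)]
  linarith

lemma l1_of_l2 {Ω : Type*} {mΩ : MeasurableSpace Ω} {μ : Measure Ω} [IsProbabilityMeasure μ]
    (f : ℕ → Ω → ℝ) (hf : ∀ᶠ n in atTop, Integrable (f n) μ)
    (hf2 : ∀ᶠ n in atTop, Integrable (fun ω => f n ω ^ 2) μ)
    (h0 : ∀ n ω, 0 ≤ f n ω) (h : Tendsto (fun n => ∫ ω, f n ω ^ 2 ∂μ) atTop (𝓝 0)) :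
    Tendsto (fun n => ∫ ω, f n ω ∂μ) atTop (𝓝 0) := by
  have h1 : Tendsto (fun n => √(∫ ω, f n ω ^ 2 ∂μ)) atTop (𝓝 0) := by
    have := (Real.continuous_sqrt.tendsto 0).comp h
    simpa [Function.comp_def] using this
  refine squeeze_zero' (Eventually.of_forall fun n => integral_nonneg (h0 n)) ?_ h1
  filter_upwards [hf, hf2] with n a b
  apply Real.le_sqrt_of_sq_le
  set m := ∫ ω, f n ω ∂μ with hm
  have h2 : 0 ≤ ∫ ω, (f n ω - m) ^ 2 ∂μ := integral_nonneg fun ω => sq_nonneg _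
  have h3 : ∫ ω, (f n ω - m) ^ 2 ∂μ = ∫ ω, f n ω ^ 2 ∂μ - m ^ 2 := by
    have : ∀ ω, (f n ω - m) ^ 2 = f n ω ^ 2 - (2 * m) * f n ω + m ^ 2 := fun ω => by ring
    simp only [this]
    rw [integral_add (show Integrable (fun ω => f n ω ^ 2 - (2 * m) * f n ω) μ from
      b.sub (a.const_mul _)) (integrable_const _), integral_sub b (a.const_mul _),
      integral_const_mul, ← hm]
    simp; ring
  linarith

/-- pointwise generator estimate for the squared statistic -/
lemma gen_sq (α θ ρ : ℝ) (hα : 0 < α) (d : ℕ) (b M D : ℝ) (hb : 0 ≤ b) (hM : 0 ≤ M) (hD : 0 ≤ D) :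
    ∃ C : ℝ, 0 ≤ C ∧ ∀ (k z u0 : ℝ) (u q : ℕ → ℝ), 1 ≤ k → |z| ≤ b * k → |u0| ≤ M →
      (∀ j ∈ Finset.Icc 1 d, |u j| ≤ M) → (∀ j ∈ Finset.Icc 1 d, 0 ≤ q j ∧ q j ≤ D * k) →
      0 ≤ α * k + θ →
      ((α * k + θ) * u0 + ∑ j ∈ Finset.Icc 1 d, q j * u j = θ * u0 - ρ * z) →
      (α * k + θ) * (((z + u0) / (k + 1)) ^ 2 - (z / k) ^ 2) +
        ∑ j ∈ Finset.Icc 1 d, q j * (((z + u j) / k) ^ 2 - (z / k) ^ 2)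
      ≤ -(2 * (ρ + α)) * (z / k) ^ 2 + C / k := by
  refine ⟨2 * b * (|θ| * (M + b) + (α + |θ|) * (M + b)) + (α + |θ|) * (M + b) ^ 2 + d * (D * M ^ 2),
    by positivity, ?_⟩
  intro k z u0 u q hk hz hu0 hu hq hp hdr
  have hk0 : 0 < k := by linarith
  set x := z / k with hx
  have hzx : z = x * k := by rw [hx]; field_simp
  have hxb : |x| ≤ b := by rw [hx, abs_div, abs_of_pos hk0, div_le_iff₀ hk0]; exact hz
  have hA : α * k + θ ≤ (α + |θ|) * k := by
    have := le_abs_self θ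
    have h2 : |θ| ≤ |θ| * k := le_mul_of_one_le_right (abs_nonneg _) hk
    linarith
  have hux : |u0 - x| ≤ M + b := (abs_sub _ _).trans (add_le_add hu0 hxb)
  -- sum of the growth terms
  have hs : ∑ j ∈ Finset.Icc 1 d, q j * (((z + u j) / k) ^ 2 - x ^ 2)
      = 2 * x / k * (θ * u0 - ρ * z - (α * k + θ) * u0) + ∑ j ∈ Finset.Icc 1 d, q j * u j ^ 2 / k ^ 2 := by
    rw [← hdr, add_sub_cancel_left, Finset.mul_sum, ← Finset.sum_add_distrib]
    apply Finset.sum_congr rfl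
    intro j _
    rw [hzx]; field_simp; ring
  have hs2 : ∑ j ∈ Finset.Icc 1 d, q j * u j ^ 2 / k ^ 2 ≤ d * (D * M ^ 2) / k := by
    calc ∑ j ∈ Finset.Icc 1 d, q j * u j ^ 2 / k ^ 2
        ≤ ∑ j ∈ Finset.Icc 1 d, D * M ^ 2 / k := by
          apply Finset.sum_le_sum
          intro j hj
          have h1 := hq j hj
          have h2 : u j ^ 2 ≤ M ^ 2 := by rw [← sq_abs]; gcongr; exact hu j hj
          calc q j * u j ^ 2 / k ^ 2 ≤ (D * k) * M ^ 2 / k ^ 2 := by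
                gcongr; exact h1.2
            _ = D * M ^ 2 / k := by field_simp
      _ = _ := by simp; ring
  have hs0 : (α * k + θ) * (((z + u0) / (k + 1)) ^ 2 - x ^ 2)
      = 2 * x * ((α * k + θ) * (u0 - x) / k - (α * k + θ) / (k + 1) * (u0 - x) / k)
        + (α * k + θ) * ((u0 - x) / (k + 1)) ^ 2 := by
    have : k + 1 ≠ 0 := by linarith
    rw [hzx]; field_simp; ring
  have hs3 : (α * k + θ) * ((u0 - x) / (k + 1)) ^ 2 ≤ (α + |θ|) * (M + b) ^ 2 / k := by
    have h1 : (u0 - x) ^ 2 ≤ (M + b) ^ 2 := by rw [← sq_abs]; gcongr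
    calc (α * k + θ) * ((u0 - x) / (k + 1)) ^ 2 = (α * k + θ) * (u0 - x) ^ 2 / (k + 1) ^ 2 := by
          rw [div_pow]; ring
      _ ≤ ((α + |θ|) * k) * (M + b) ^ 2 / k ^ 2 := by gcongr; linarith
      _ = _ := by field_simp
  have hdiv : (α * k + θ) / (k + 1) ≤ α + |θ| := by
    rw [div_le_iff₀ (by linarith)]
    have : 0 ≤ α + |θ| := by positivity
    nlinarith
  have hdiv0 : 0 ≤ (α * k + θ) / (k + 1) := by positivity
  have hmain : 2 * x * (θ * (u0 - x) - (α * k + θ) / (k + 1) * (u0 - x))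
      ≤ 2 * b * (|θ| * (M + b) + (α + |θ|) * (M + b)) := by
    refine (le_abs_self _).trans ?_
    rw [abs_mul, abs_mul, abs_two]
    gcongr
    refine (abs_sub _ _).trans ?_
    rw [abs_mul, abs_mul, abs_of_nonneg hdiv0]
    gcongr
  have hmain' : 2 * x * (θ * (u0 - x) - (α * k + θ) / (k + 1) * (u0 - x)) / k
      ≤ 2 * b * (|θ| * (M + b) + (α + |θ|) * (M + b)) / k := by gcongr
  rw [hs, hs0]
  have e : 2 * x * ((α * k + θ) * (u0 - x) / k - (α * k + θ) / (k + 1) * (u0 - x) / k)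
      + 2 * x / k * (θ * u0 - ρ * z - (α * k + θ) * u0)
      = -(2 * (ρ + α)) * x ^ 2 +
        2 * x * (θ * (u0 - x) - (α * k + θ) / (k + 1) * (u0 - x)) / k := by
    have : k + 1 ≠ 0 := by linarith
    rw [hzx]; field_simp; ring
  have e2 : ∀ a b c : ℝ, (a + b + c) / k = a / k + b / k + c / k := by intros; ring
  rw [e2]
  linarith



section moments
variable {α θ : ℝ} {Ω : Type*} {mΩ : MeasurableSpace Ω} {μ : Measure Ω} {F : Filtration ℕ mΩ}
  {K : ℕ → Ω → ℕ} {B : ℕ → ℕ → Ω → ℕ}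

lemma invK_tendsto (hEP : IsEwensPitman α θ μ F K B) (hα0 : 0 < α) (hα1 : α < 1)
    (hθ : 0 < α + θ) : Tendsto (fun n => ∫ ω, 1 / (K n ω : ℝ) ∂μ) atTop (𝓝 0) := by
  have hc : 0 < min α (α + θ) / 2 := by positivity
  set c := min α (α + θ) / 2 with hcdef
  refine gron θ c hc _ (fun _ => 0) (fun n => integral_nonneg fun ω => by positivity)
    tendsto_const_nhds ?_
  filter_upwards [eventually_ge_atTop 1] with n hn
  have hn' : (1 : ℝ) ≤ n := by exact_mod_cast hn
  have hN : 0 < (n : ℝ) + θ := by linarith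
  have hT := transition hEP (E := ℝ) hα1 hθ n hn (d := 1) le_rfl (β := fun _ => 0) rfl
    (g := fun k _ => 1 / (k : ℝ)) (fun k => measurable_const) (by
      intro k z
      rw [Real.norm_of_nonneg (by positivity)]
      rcases Nat.eq_zero_or_pos k with rfl | h
      · simp; positivity
      · have : (1 : ℝ) ≤ k := by exact_mod_cast h
        have : 1 / (k : ℝ) ≤ 1 := by rw [div_le_one (by linarith)]; exact this
        nlinarith [sq_nonneg z])
  obtain ⟨h1, h2, h3⟩ := hT
  have h1 := h1 n hn
  rw [h3]
  have : ∫ ω, (((α * (K n ω : ℝ) + θ) / ((n : ℝ) + θ)) •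
        (1 / ((K n ω + 1 : ℕ) : ℝ) - 1 / (K n ω : ℝ)) +
      ∑ j ∈ Finset.Icc (1:ℕ) 1, ((((j : ℝ) - α) * (B j n ω : ℝ)) / ((n : ℝ) + θ)) •
        (1 / (K n ω : ℝ) - 1 / (K n ω : ℝ))) ∂μ ≤ ∫ ω, -(c / (n + θ)) * (1 / (K n ω : ℝ)) ∂μ := by
    refine integral_mono_ae h2 (h1.const_mul _) ?_
    filter_upwards [ep_basic hEP n hn] with ω hω
    have hK : (1 : ℝ) ≤ K n ω := by exact_mod_cast hω.1
    simp only [sub_self, smul_zero, mul_zero, Finset.sum_const_zero, add_zero, smul_eq_mul]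
    generalize (n : ℝ) + θ = N at hN
    push_cast
    generalize (K n ω : ℝ) = k at hK
    have h4 : c * (k + 1) ≤ α * k + θ := by
      rw [hcdef]
      rcases le_total 0 θ with h | h
      · have := min_le_left α (α + θ); nlinarith
      · have := min_le_right α (α + θ); nlinarith
    have e : (α * k + θ) / N * (1 / (k + 1) - 1 / k) = -((α * k + θ) / (N * k * (k + 1))) := by
      field_simp; ring
    have e2 : -(c / N) * (1 / k) = - ((c * (k + 1)) / (N * k * (k + 1))) := by
      field_simp
    rw [e, e2]
    gcongr
  rw [integral_const_mul] at this
  refine (add_le_add_right this _).trans (le_of_eq ?_)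
  ring

lemma V_sq_tendsto (hEP : IsEwensPitman α θ μ F K B) (hα0 : 0 < α) (hα1 : α < 1)
    (hθ : 0 < α + θ) (d r : ℕ) (hr1 : 1 ≤ r) (hr : r ≤ d) :
    Tendsto (fun n => ∫ ω, (zz (cH α r) d K B n ω / (K n ω : ℝ)) ^ 2 ∂μ) atTop (𝓝 0) := by
  have hprob := hEP.prob
  obtain ⟨M, hM0, hM⟩ : ∃ M, 0 ≤ M ∧ ∀ j ≤ d, |cH α r (j + 1) - cH α r j| ≤ M := by
    refine ⟨∑ j ∈ Finset.range (d + 1), |cH α r (j + 1) - cH α r j|, by positivity, fun j hj => ?_⟩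
    exact Finset.single_le_sum (f := fun j => |cH α r (j + 1) - cH α r j|)
      (fun i _ => abs_nonneg _) (Finset.mem_range.2 (by omega))
  obtain ⟨C, hC0, hC⟩ := gen_sq α θ (r - α) hα0 d (bb (cH α r) d) M d (bb_nonneg _ _) hM0
    (by positivity)
  have hr' : (1 : ℝ) ≤ r := by exact_mod_cast hr1
  refine gron θ (2 * r) (by positivity) _ (fun n => C * ∫ ω, 1 / (K n ω : ℝ) ∂μ)
    (fun n => integral_nonneg fun ω => by positivity)
    (by simpa using (invK_tendsto hEP hα0 hα1 hθ).const_mul C) ?_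
  filter_upwards [eventually_ge_atTop 1] with n hn
  have hn' : (1 : ℝ) ≤ n := by exact_mod_cast hn
  have hN : 0 < (n : ℝ) + θ := by linarith
  have hβ : cH α r (d + 1) = 0 := by simp [cH]; omega
  obtain ⟨h1, h2, h3⟩ := transition hEP (E := ℝ) hα1 hθ n hn (d := d) (hr1.trans hr) (β := cH α r) hβ
    (g := fun k z => (z / (k : ℝ)) ^ 2) (fun k => by fun_prop) (by
      intro k z
      rw [Real.norm_of_nonneg (by positivity)]
      rcases Nat.eq_zero_or_pos k with rfl | h
      · simp; positivity
      · have : (1 : ℝ) ≤ k := by exact_mod_cast h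
        rw [div_pow]
        have : z ^ 2 / (k : ℝ) ^ 2 ≤ z ^ 2 := div_le_self (sq_nonneg _) (by nlinarith)
        linarith)
  have h1 := h1 n hn
  have hKint : Integrable (fun ω => 1 / (K n ω : ℝ)) μ := by
    refine Integrable.of_bound (C := 1) ?_ ?_
    · have := (hEP.meas_K n).mono (F.le n) le_rfl
      exact (Measurable.aestronglyMeasurable (by
        exact (measurable_const.div ((measurable_from_top (f := fun k : ℕ => (k : ℝ))).comp this))))
    · filter_upwards [ep_basic hEP n hn] with ω hω
      have hK : (1 : ℝ) ≤ K n ω := by exact_mod_cast hω.1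
      rw [Real.norm_of_nonneg (by positivity), div_le_one (by linarith)]; exact hK
  rw [h3]
  have key : ∫ ω, (((α * (K n ω : ℝ) + θ) / ((n : ℝ) + θ)) •
        (((zz (cH α r) d K B n ω + (cH α r 1 - cH α r 0)) / ((K n ω + 1 : ℕ) : ℝ)) ^ 2 -
          (zz (cH α r) d K B n ω / (K n ω : ℝ)) ^ 2) +
      ∑ j ∈ Finset.Icc 1 d, ((((j : ℝ) - α) * (B j n ω : ℝ)) / ((n : ℝ) + θ)) •
        (((zz (cH α r) d K B n ω + (cH α r (j + 1) - cH α r j)) / (K n ω : ℝ)) ^ 2 -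
          (zz (cH α r) d K B n ω / (K n ω : ℝ)) ^ 2)) ∂μ ≤
      ∫ ω, (-(2 * r / (n + θ)) * (zz (cH α r) d K B n ω / (K n ω : ℝ)) ^ 2 +
        C / (n + θ) * (1 / (K n ω : ℝ))) ∂μ := by
    refine integral_mono_ae h2 ((h1.const_mul _).add (hKint.const_mul _)) ?_
    filter_upwards [ep_basic hEP n hn, zz_bound hEP (cH α r) d n hn] with ω hω hz
    have hK : (1 : ℝ) ≤ K n ω := by exact_mod_cast hω.1
    have hθK : 0 ≤ α * (K n ω : ℝ) + θ := by nlinarith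
    have := hC (K n ω) (zz (cH α r) d K B n ω) (cH α r 1 - cH α r 0)
      (fun j => cH α r (j + 1) - cH α r j) (fun j => ((j : ℝ) - α) * (B j n ω : ℝ)) hK hz
      (hM 0 (by omega)) (fun j hj => hM j (Finset.mem_Icc.1 hj).2) (by
        intro j hj
        obtain ⟨hj1, hj2⟩ := Finset.mem_Icc.1 hj
        have a1 : (1 : ℝ) ≤ j := by exact_mod_cast hj1
        have a2 : (j : ℝ) ≤ d := by exact_mod_cast hj2
        have a3 : (B j n ω : ℝ) ≤ K n ω := by exact_mod_cast hω.2.2 j hj1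
        have a4 : (0 : ℝ) ≤ B j n ω := by positivity
        constructor
        · apply mul_nonneg <;> linarith
        · apply mul_le_mul <;> linarith) hθK (by
        have e1 : ∀ j : ℕ, ((j : ℝ) - α) * (B j n ω : ℝ) * (cH α r (j + 1) - cH α r j) =
            -(r - α) * (cH α r j * B j n ω) := by
          intro j
          have := cH_drift α r j
          linear_combination (B j n ω : ℝ) * this
        have e2 := cH_drift α r 0
        simp only [e1, ← Finset.mul_sum, zz]
        simp at e2
        linear_combination (-(K n ω : ℝ)) * e2)
    simp only [smul_eq_mul]
    push_cast
    have e : ∀ a b : ℝ, a / (n + θ) * b = (a * b) / (n + θ) := fun a b => by ring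
    simp only [e]
    rw [← Finset.sum_div, ← add_div]
    calc _ ≤ (-(2 * ((r : ℝ) - α + α)) * (zz (cH α r) d K B n ω / (K n ω : ℝ)) ^ 2 + C / (K n ω : ℝ)) / (n + θ) := by
          gcongr
      _ = _ := by ring
  rw [integral_add (h1.const_mul _) (hKint.const_mul _), integral_const_mul, integral_const_mul] at key
  calc _ ≤ _ := add_le_add_right key _
    _ = _ := by ring

lemma meas_K' (hEP : IsEwensPitman α θ μ F K B) (n : ℕ) : Measurable (fun ω => (K n ω : ℝ)) :=
  (measurable_from_top (f := fun k : ℕ => (k : ℝ))).comp ((hEP.meas_K n).mono (F.le n) le_rfl)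

lemma meas_B' (hEP : IsEwensPitman α θ μ F K B) (i n : ℕ) : Measurable (fun ω => (B i n ω : ℝ)) :=
  (measurable_from_top (f := fun k : ℕ => (k : ℝ))).comp ((hEP.meas_B i n).mono (F.le n) le_rfl)

lemma meas_zz' (hEP : IsEwensPitman α θ μ F K B) (β : ℕ → ℝ) (d n : ℕ) :
    Measurable (zz β d K B n) := (meas_zz hEP β d n).mono (F.le n) le_rfl

lemma int_V (hEP : IsEwensPitman α θ μ F K B) (β : ℕ → ℝ) (d n : ℕ) (hn : 1 ≤ n) :
    Integrable (fun ω => |zz β d K B n ω / (K n ω : ℝ)|) μ := by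
  have hprob := hEP.prob
  refine Integrable.of_bound (C := bb β d)
    ((meas_zz' hEP β d n).div (meas_K' hEP n)).abs.aestronglyMeasurable ?_
  filter_upwards [ep_basic hEP n hn, zz_bound hEP β d n hn] with ω hω hz
  have hK : (1 : ℝ) ≤ K n ω := by exact_mod_cast hω.1
  rw [Real.norm_eq_abs, abs_abs, abs_div, Nat.abs_cast, div_le_iff₀ (by linarith)]
  exact hz

lemma int_Y (hEP : IsEwensPitman α θ μ F K B) (i n : ℕ) (hi : 1 ≤ i) (hn : 1 ≤ n) :
    Integrable (fun ω => |(B i n ω : ℝ) / (K n ω : ℝ) - sibuya α i|) μ := by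
  have hprob := hEP.prob
  refine Integrable.of_bound (C := 1 + |sibuya α i|)
    (((meas_B' hEP i n).div (meas_K' hEP n)).sub_const _).abs.aestronglyMeasurable ?_
  filter_upwards [ep_basic hEP n hn] with ω hω
  have hK : (1 : ℝ) ≤ K n ω := by exact_mod_cast hω.1
  have hB : (B i n ω : ℝ) ≤ K n ω := by exact_mod_cast hω.2.2 i hi
  rw [Real.norm_eq_abs, abs_abs]
  refine (abs_sub _ _).trans ?_
  gcongr
  rw [abs_of_nonneg (by positivity), div_le_one (by linarith)]
  exact hB

lemma int_S (hEP : IsEwensPitman α θ μ F K B) (n : ℕ) (hn : 1 ≤ n) :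
    Integrable (fun ω => 1 / √(K n ω : ℝ)) μ := by
  have hprob := hEP.prob
  refine Integrable.of_bound (C := 1)
    (measurable_const.div (meas_K' hEP n).sqrt).aestronglyMeasurable ?_
  filter_upwards [ep_basic hEP n hn] with ω hω
  have hK : (1 : ℝ) ≤ √(K n ω : ℝ) := by
    rw [Real.one_le_sqrt]; exact_mod_cast hω.1
  rw [Real.norm_of_nonneg (by positivity), div_le_one (by linarith)]
  exact hK

lemma int_K1 (hEP : IsEwensPitman α θ μ F K B) (n : ℕ) (hn : 1 ≤ n) :
    Integrable (fun ω => 1 / (K n ω : ℝ)) μ := by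
  have hprob := hEP.prob
  refine Integrable.of_bound (C := 1)
    (measurable_const.div (meas_K' hEP n)).aestronglyMeasurable ?_
  filter_upwards [ep_basic hEP n hn] with ω hω
  have hK : (1 : ℝ) ≤ (K n ω : ℝ) := by exact_mod_cast hω.1
  rw [Real.norm_of_nonneg (by positivity), div_le_one (by linarith)]
  exact hK

lemma S_tendsto (hEP : IsEwensPitman α θ μ F K B) (hα0 : 0 < α) (hα1 : α < 1)
    (hθ : 0 < α + θ) : Tendsto (fun n => ∫ ω, 1 / √(K n ω : ℝ) ∂μ) atTop (𝓝 0) := by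
  have hprob := hEP.prob
  have e : ∀ n ω, (1 / √(K n ω : ℝ)) ^ 2 = 1 / (K n ω : ℝ) := fun n ω => by
    rw [div_pow, Real.sq_sqrt (by positivity), one_pow]
  refine l1_of_l2 (fun n ω => 1 / √(K n ω : ℝ)) ?_ ?_ (fun n ω => by positivity) ?_
  · filter_upwards [eventually_ge_atTop 1] with n hn using int_S hEP n hn
  · filter_upwards [eventually_ge_atTop 1] with n hn
    simp only [e]; exact int_K1 hEP n hn
  · simp only [e]; exact invK_tendsto hEP hα0 hα1 hθ

lemma V_tendsto (hEP : IsEwensPitman α θ μ F K B) (hα0 : 0 < α) (hα1 : α < 1)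
    (hθ : 0 < α + θ) (d r : ℕ) (hr1 : 1 ≤ r) (hr : r ≤ d) :
    Tendsto (fun n => ∫ ω, |zz (cH α r) d K B n ω / (K n ω : ℝ)| ∂μ) atTop (𝓝 0) := by
  have hprob := hEP.prob
  refine l1_of_l2 (fun n ω => |zz (cH α r) d K B n ω / (K n ω : ℝ)|) ?_ ?_
    (fun n ω => abs_nonneg _) ?_
  · filter_upwards [eventually_ge_atTop 1] with n hn using int_V hEP _ _ n hn
  · filter_upwards [eventually_ge_atTop 1] with n hn
    refine Integrable.of_bound (C := bb (cH α r) d ^ 2)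
      (((meas_zz' hEP _ d n).div (meas_K' hEP n)).abs.pow_const 2).aestronglyMeasurable ?_
    filter_upwards [ep_basic hEP n hn, zz_bound hEP (cH α r) d n hn] with ω hω hz
    have hK : (1 : ℝ) ≤ K n ω := by exact_mod_cast hω.1
    rw [Real.norm_of_nonneg (by positivity)]
    gcongr
    rw [abs_div, Nat.abs_cast, div_le_iff₀ (by linarith)]
    exact hz
  · simp only [sq_abs]; exact V_sq_tendsto hEP hα0 hα1 hθ d r hr1 hr

lemma Y_tendsto (hEP : IsEwensPitman α θ μ F K B) (hα0 : 0 < α) (hα1 : α < 1)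
    (hθ : 0 < α + θ) (r : ℕ) (hr1 : 1 ≤ r) :
    Tendsto (fun n => ∫ ω, |(B r n ω : ℝ) / (K n ω : ℝ) - sibuya α r| ∂μ) atTop (𝓝 0) := by
  induction r using Nat.strong_induction_on with
  | _ r ih =>
  have hlim : Tendsto (fun n => ∫ ω, |zz (cH α r) r K B n ω / (K n ω : ℝ)| ∂μ +
      ∑ i ∈ Finset.Icc 1 (r - 1), |cH α r i| *
        ∫ ω, |(B i n ω : ℝ) / (K n ω : ℝ) - sibuya α i| ∂μ) atTop (𝓝 0) := by
    have h2 : Tendsto (fun n => ∑ i ∈ Finset.Icc 1 (r - 1), |cH α r i| *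
        ∫ ω, |(B i n ω : ℝ) / (K n ω : ℝ) - sibuya α i| ∂μ) atTop
        (𝓝 (∑ i ∈ Finset.Icc 1 (r - 1), |cH α r i| * 0)) := by
      refine tendsto_finsetSum _ fun i hi => ?_
      obtain ⟨a, b⟩ := Finset.mem_Icc.1 hi
      exact (ih i (by omega) a).const_mul _
    simpa using (V_tendsto hEP hα0 hα1 hθ r r hr1 le_rfl).add h2
  refine squeeze_zero' (Eventually.of_forall fun n => integral_nonneg fun ω => abs_nonneg _) ?_ hlim
  filter_upwards [eventually_ge_atTop 1] with n hn
  have hint : ∀ i ∈ Finset.Icc 1 (r - 1), Integrable (fun ω => |cH α r i| *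
      |(B i n ω : ℝ) / (K n ω : ℝ) - sibuya α i|) μ := fun i hi =>
    (int_Y hEP i n (Finset.mem_Icc.1 hi).1 hn).const_mul _
  have e : ∑ i ∈ Finset.Icc 1 (r - 1), |cH α r i| *
        ∫ ω, |(B i n ω : ℝ) / (K n ω : ℝ) - sibuya α i| ∂μ =
      ∫ ω, ∑ i ∈ Finset.Icc 1 (r - 1), |cH α r i| *
        |(B i n ω : ℝ) / (K n ω : ℝ) - sibuya α i| ∂μ := by
    rw [integral_finsetSum _ hint]
    simp only [integral_const_mul]
  rw [e, ← integral_add (int_V hEP _ _ n hn) (integrable_finsetSum _ hint)]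
  refine integral_mono_ae (int_Y hEP r n hr1 hn)
    ((int_V hEP _ _ n hn).add (integrable_finsetSum _ hint)) ?_
  filter_upwards [ep_basic hEP n hn] with ω hω
  have hK : (0 : ℝ) < K n ω := by exact_mod_cast hω.1
  have hm := mean_id α r r hr1 le_rfl
  have h1 : zz (cH α r) r K B n ω / (K n ω : ℝ) =
      ∑ i ∈ Finset.Icc 1 r, cH α r i * ((B i n ω : ℝ) / (K n ω : ℝ) - sibuya α i) := by
    simp only [mul_sub, Finset.sum_sub_distrib]
    have : ∑ i ∈ Finset.Icc 1 r, cH α r i * sibuya α i = cH α r 0 := by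
      rw [← hm]; exact Finset.sum_congr rfl fun i _ => mul_comm _ _
    rw [this, zz, sub_div, Finset.sum_div, mul_div_assoc, div_self hK.ne', mul_one]
    simp only [mul_div_assoc]
  have hrr : cH α r r = 1 := by simp [cH, gb_zero]
  have h2 : ∑ i ∈ Finset.Icc 1 r, cH α r i * ((B i n ω : ℝ) / (K n ω : ℝ) - sibuya α i) =
      ∑ i ∈ Finset.Icc 1 (r - 1), cH α r i * ((B i n ω : ℝ) / (K n ω : ℝ) - sibuya α i) +
      ((B r n ω : ℝ) / (K n ω : ℝ) - sibuya α r) := by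
    obtain ⟨s, rfl⟩ : ∃ s, r = s + 1 := ⟨r - 1, by omega⟩
    rw [Finset.sum_Icc_succ_top (by omega), hrr]; simp
  have h3 := h1.trans h2
  have h4 : (B r n ω : ℝ) / (K n ω : ℝ) - sibuya α r = zz (cH α r) r K B n ω / (K n ω : ℝ) -
    ∑ i ∈ Finset.Icc 1 (r - 1), cH α r i * ((B i n ω : ℝ) / (K n ω : ℝ) - sibuya α i) := by
    rw [h3]; ring

  rw [h4]
  refine (abs_sub _ _).trans ?_
  gcongr
  refine (Finset.abs_sum_le_sum_abs _ _).trans (le_of_eq ?_)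
  simp only [abs_mul]

/-- total error functional -/
def err {Ω : Type*} (α : ℝ) (d : ℕ) (K : ℕ → Ω → ℕ) (B : ℕ → ℕ → Ω → ℕ) (n : ℕ) (ω : Ω) : ℝ :=
  1 / √(K n ω : ℝ) + ∑ i ∈ Finset.Icc 1 d, |(B i n ω : ℝ) / (K n ω : ℝ) - sibuya α i| +
    ∑ r ∈ Finset.Icc 1 d, |zz (cH α r) d K B n ω / (K n ω : ℝ)|

lemma err_int (hEP : IsEwensPitman α θ μ F K B) (d n : ℕ) (hn : 1 ≤ n) :
    Integrable (err α d K B n) μ := by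
  unfold err
  refine ((int_S hEP n hn).add (integrable_finsetSum _ fun i hi => ?_)).add
    (integrable_finsetSum _ fun r _ => int_V hEP _ _ n hn)
  exact int_Y hEP i n (Finset.mem_Icc.1 hi).1 hn

lemma err_tendsto (hEP : IsEwensPitman α θ μ F K B) (hα0 : 0 < α) (hα1 : α < 1)
    (hθ : 0 < α + θ) (d : ℕ) :
    Tendsto (fun n => ∫ ω, err α d K B n ω ∂μ) atTop (𝓝 0) := by
  have h : Tendsto (fun n => ∫ ω, 1 / √(K n ω : ℝ) ∂μ +
      ∑ i ∈ Finset.Icc 1 d, ∫ ω, |(B i n ω : ℝ) / (K n ω : ℝ) - sibuya α i| ∂μ +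
      ∑ r ∈ Finset.Icc 1 d, ∫ ω, |zz (cH α r) d K B n ω / (K n ω : ℝ)| ∂μ) atTop
      (𝓝 (0 + ∑ i ∈ Finset.Icc 1 d, 0 + ∑ i ∈ Finset.Icc 1 d, 0)) := by
    refine ((S_tendsto hEP hα0 hα1 hθ).add (tendsto_finsetSum _ fun i hi => ?_)).add
      (tendsto_finsetSum _ fun r hr => ?_)
    · exact Y_tendsto hEP hα0 hα1 hθ i (Finset.mem_Icc.1 hi).1
    · exact V_tendsto hEP hα0 hα1 hθ d r (Finset.mem_Icc.1 hr).1 (Finset.mem_Icc.1 hr).2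
  simp only [Finset.sum_const_zero, add_zero] at h
  refine h.congr' ?_
  filter_upwards [eventually_ge_atTop 1] with n hn
  have i2 : ∀ i ∈ Finset.Icc 1 d, Integrable
      (fun ω => |(B i n ω : ℝ) / (K n ω : ℝ) - sibuya α i|) μ := fun i hi =>
    int_Y hEP i n (Finset.mem_Icc.1 hi).1 hn
  have i3 : ∀ r ∈ Finset.Icc 1 d, Integrable
      (fun ω => |zz (cH α r) d K B n ω / (K n ω : ℝ)|) μ := fun i hi => int_V hEP _ _ n hn
  rw [← integral_finsetSum _ i2, ← integral_finsetSum _ i3,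
    ← integral_add (int_S hEP n hn) (integrable_finsetSum _ i2),
    ← integral_add (show Integrable (fun ω => 1 / √(K n ω : ℝ) + 
      ∑ i ∈ Finset.Icc 1 d, |(B i n ω : ℝ) / (K n ω : ℝ) - sibuya α i|) μ from
      (int_S hEP n hn).add (integrable_finsetSum _ i2)) (integrable_finsetSum _ i3)]
  rfl

end moments


lemma cexp3 (x : ℝ) : ‖Complex.exp (Complex.I * x) - 1 - Complex.I * x + x ^ 2 / 2‖ ≤ 4 * |x| ^ 3 := by
  rcases le_total |x| 1 with h | h
  · have h1 := Complex.exp_bound (x := Complex.I * x) (by simpa using h) (n := 3) (by norm_num)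
    simp [Finset.sum_range_succ, Nat.factorial] at h1
    have e : Complex.exp (Complex.I * x) - (1 + Complex.I * x + (Complex.I * x) ^ 2 / 2) =
      Complex.exp (Complex.I * x) - 1 - Complex.I * x + x ^ 2 / 2 := by
      rw [mul_pow, Complex.I_sq]; ring
    rw [e] at h1
    refine h1.trans ?_
    have : 0 ≤ |x| ^ 3 := by positivity
    nlinarith
  · have h1 : ‖Complex.exp (Complex.I * x)‖ = 1 := by rw [mul_comm, Complex.norm_exp_ofReal_mul_I]
    calc ‖Complex.exp (Complex.I * x) - 1 - Complex.I * x + x ^ 2 / 2‖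
        ≤ ‖Complex.exp (Complex.I * x)‖ + ‖(1 : ℂ)‖ + ‖Complex.I * x‖ + ‖(x : ℂ) ^ 2 / 2‖ := by
          refine (norm_add_le _ _).trans ?_
          gcongr
          refine (norm_sub_le _ _).trans ?_
          gcongr
          exact norm_sub_le _ _
      _ = 1 + 1 + |x| + |x| ^ 2 / 2 := by rw [h1]; simp
      _ ≤ _ := by nlinarith [sq_nonneg (|x|), mul_nonneg (abs_nonneg x) (abs_nonneg x), mul_nonneg (sq_nonneg |x|) (sub_nonneg.2 h), mul_nonneg (abs_nonneg x) (sub_nonneg.2 h)]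

lemma cexp2 (x : ℝ) : ‖Complex.exp (Complex.I * x) - 1 - Complex.I * x‖ ≤ 3 * x ^ 2 := by
  rw [← sq_abs]
  rcases le_total |x| 1 with h | h
  · have h1 := Complex.norm_exp_sub_one_sub_id_le (x := Complex.I * x) (by simpa using h)
    refine h1.trans ?_
    simp only [norm_mul, Complex.norm_I, Complex.norm_real, one_mul, Real.norm_eq_abs]
    nlinarith [sq_nonneg |x|]
  · have h1 : ‖Complex.exp (Complex.I * x)‖ = 1 := by rw [mul_comm, Complex.norm_exp_ofReal_mul_I]
    calc ‖Complex.exp (Complex.I * x) - 1 - Complex.I * x‖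
        ≤ ‖Complex.exp (Complex.I * x)‖ + ‖(1 : ℂ)‖ + ‖Complex.I * x‖ := by
          refine (norm_sub_le _ _).trans ?_
          gcongr
          exact norm_sub_le _ _
      _ = 1 + 1 + |x| := by rw [h1]; simp
      _ ≤ _ := by nlinarith

lemma x0_exp (z u s s' : ℝ) (hs : 1 ≤ s) (hs' : s ≤ s') (h : s' ^ 2 = s ^ 2 + 1) :
    |(z + u) / s' - z / s - (u / s - z / (2 * s ^ 3))| ≤ (|u| + |z| / s ^ 2) / s ^ 3 := by
  have h0 : 0 < s := by linarith
  have h0' : 0 < s' := by linarith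
  have hd : s * (s' - s) ≤ 1 / 2 := by nlinarith
  have e1 : 1 / s' - 1 / s = -(1 / (s * s' * (s + s'))) := by
    field_simp; nlinarith
  have e2 : 1 / s' - 1 / s + 1 / (2 * s ^ 3) =
      (s * (s' - s) + 1) / (2 * s ^ 3 * (s' * (s + s'))) := by
    rw [e1]; field_simp; nlinarith
  have b1 : |1 / s' - 1 / s| ≤ 1 / s ^ 3 := by
    rw [e1, abs_neg, abs_of_nonneg (by positivity)]
    apply one_div_le_one_div_of_le (by positivity)
    calc s ^ 3 ≤ s * s * (s + s) := by nlinarith [pow_pos h0 3]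
      _ ≤ _ := by gcongr
  have b2 : |1 / s' - 1 / s + 1 / (2 * s ^ 3)| ≤ 1 / s ^ 5 := by
    have : 0 ≤ s * (s' - s) := mul_nonneg h0.le (by linarith)
    rw [e2, abs_of_nonneg (by positivity), div_le_div_iff₀ (by positivity) (by positivity)]
    calc (s * (s' - s) + 1) * s ^ 5 ≤ 2 * s ^ 5 := by gcongr; linarith
      _ ≤ 2 * s ^ 3 * (s * (s + s)) := by nlinarith [pow_pos h0 5]
      _ ≤ 1 * (2 * s ^ 3 * (s' * (s + s'))) := by rw [one_mul]; gcongr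
  have e3 : (z + u) / s' - z / s - (u / s - z / (2 * s ^ 3)) =
      z * (1 / s' - 1 / s + 1 / (2 * s ^ 3)) + u * (1 / s' - 1 / s) := by ring
  rw [e3]
  calc _ ≤ |z| * |1 / s' - 1 / s + 1 / (2 * s ^ 3)| + |u| * |1 / s' - 1 / s| := by
        rw [← abs_mul, ← abs_mul]; exact abs_add_le _ _
    _ ≤ |z| * (1 / s ^ 5) + |u| * (1 / s ^ 3) := by gcongr
    _ = _ := by field_simp; ring

lemma rhs_est (w σ : ℝ) (hw : 0 ≤ w) :
    ‖(Complex.exp (Complex.I * ((-σ : ℝ) : ℂ)) * ((1 - w : ℝ) : ℂ) - 1) -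
      (-Complex.I * σ - w)‖ ≤ 3 * σ ^ 2 + w * |σ| := by
  have h1 := cexp2 (-σ)
  have h2 : ‖Complex.exp (Complex.I * ((-σ : ℝ) : ℂ)) - 1‖ ≤ |σ| := by
    have := Real.norm_exp_I_mul_ofReal_sub_one_le (x := -σ)
    simpa using this
  have e : (Complex.exp (Complex.I * ((-σ : ℝ) : ℂ)) * ((1 - w : ℝ) : ℂ) - 1) -
      (-Complex.I * σ - w) = (Complex.exp (Complex.I * ((-σ : ℝ) : ℂ)) - 1 - Complex.I * ((-σ : ℝ) : ℂ))
        - (w : ℂ) * (Complex.exp (Complex.I * ((-σ : ℝ) : ℂ)) - 1) := by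
    push_cast; ring
  rw [e]
  refine (norm_sub_le _ _).trans ?_
  rw [norm_mul, Complex.norm_real, Real.norm_of_nonneg hw]
  have : (-σ) ^ 2 = σ ^ 2 := by ring
  rw [this] at h1
  gcongr


lemma abs_mul_le' {a b x y : ℝ} (h1 : |a| ≤ x) (h2 : |b| ≤ y) : |a * b| ≤ x * y := by
  rw [abs_mul]; exact mul_le_mul h1 h2 (abs_nonneg _) ((abs_nonneg _).trans h1)

lemma x0_bounds (R τ s s' e z u0 : ℝ) (hR : 1 ≤ R) (hτ : 0 ≤ τ)
    (hs : 1 ≤ s) (hs' : s ≤ s') (h : s' ^ 2 = s ^ 2 + 1) (he : 1 / s ≤ e)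
    (hu0 : |u0| ≤ R * τ) (hz : |z| ≤ R * τ * s ^ 2) (hze : |z| ≤ R * τ * s ^ 2 * e) :
    |(z + u0) / s' - z / s - (u0 / s - z / (2 * s ^ 3))| ≤ 2 * R * τ / s ^ 3 ∧
    |(z + u0) / s' - z / s - u0 / s| ≤ 3 * R * τ * e / s ∧
    |(z + u0) / s' - z / s| ≤ 4 * R * τ / s := by
  have hs0 : 0 < s := by linarith
  have hRτ : 0 ≤ R * τ := by positivity
  have h1 := x0_exp z u0 s s' hs hs' h
  have h2 : (|u0| + |z| / s ^ 2) / s ^ 3 ≤ 2 * R * τ / s ^ 3 := by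
    gcongr
    have : |z| / s ^ 2 ≤ R * τ := by rw [div_le_iff₀ (by positivity)]; exact hz
    linarith
  have h1 := h1.trans h2
  have i1 : 1 / s ≤ 1 := by rw [div_le_one hs0]; exact hs
  have i0 : 0 < 1 / s := by positivity
  have h3 : 2 * R * τ / s ^ 3 ≤ 2 * R * τ * e / s := by
    have : 2 * R * τ / s ^ 3 = 2 * R * τ * (1 / s * (1 / s)) / s := by field_simp
    rw [this]
    gcongr
    nlinarith
  have h3' : 2 * R * τ / s ^ 3 ≤ 2 * R * τ / s := by
    gcongr
    nlinarith [sq_nonneg s, mul_nonneg (sq_nonneg s) (sub_nonneg.2 hs)]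
  have h4 : |z / (2 * s ^ 3)| ≤ R * τ * e / s := by
    rw [abs_div, abs_of_pos (show 0 < 2 * s ^ 3 by positivity), div_le_iff₀ (by positivity)]
    have : R * τ * e / s * (2 * s ^ 3) = 2 * (R * τ * s ^ 2 * e) := by field_simp
    rw [this]
    have := abs_nonneg z
    linarith
  have h4' : |z / (2 * s ^ 3)| ≤ R * τ / s := by
    rw [abs_div, abs_of_pos (show 0 < 2 * s ^ 3 by positivity), div_le_iff₀ (by positivity)]
    have : R * τ / s * (2 * s ^ 3) = 2 * (R * τ * s ^ 2) := by field_simp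
    rw [this]
    have := abs_nonneg z
    linarith
  have h5 : |u0 / s| ≤ R * τ / s := by
    rw [abs_div, abs_of_pos hs0]; gcongr
  refine ⟨h1, ?_, ?_⟩
  · have : (z + u0) / s' - z / s - u0 / s = ((z + u0) / s' - z / s - (u0 / s - z / (2 * s ^ 3)))
      - z / (2 * s ^ 3) := by ring
    rw [this]
    refine (abs_sub _ _).trans ?_
    calc _ ≤ 2 * R * τ * e / s + R * τ * e / s := add_le_add (h1.trans h3) h4
      _ = _ := by ring
  · have : (z + u0) / s' - z / s = ((z + u0) / s' - z / s - (u0 / s - z / (2 * s ^ 3)))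
      + (u0 / s - z / (2 * s ^ 3)) := by ring
    rw [this]
    refine (abs_add_le _ _).trans ?_
    calc _ ≤ 2 * R * τ / s + (R * τ / s + R * τ / s) := add_le_add (h1.trans h3')
            ((abs_sub _ _).trans (add_le_add h5 h4'))
      _ = _ := by ring

lemma first_order (J : Finset ℕ) (R α θ τ s x0 e z A u0 q0 : ℝ) (u q : ℕ → ℝ) (hR : 1 ≤ R)
    (hτ : 0 ≤ τ) (hθ : |θ| ≤ R)
    (hs : 1 ≤ s) (he : 1 / s ≤ e)
    (hx : |x0 - (u0 / s - z / (2 * s ^ 3))| ≤ 2 * R * τ / s ^ 3)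
    (hu0 : |u0| ≤ R * τ) (hz : |z| ≤ R * τ * s ^ 2)
    (hq0 : q0 = α * s ^ 2 + θ) (hq1 : |q0| ≤ R * s ^ 2)
    (hA : q0 * u0 + ∑ j ∈ J, q j * u j = θ * u0 - A) :
    |q0 * x0 + ∑ j ∈ J, q j * (u j / s) + (A + α / 2 * z) / s| ≤ 4 * R ^ 2 * τ * e := by
  have hs0 : 0 < s := by linarith
  set δ := x0 - (u0 / s - z / (2 * s ^ 3)) with hδ
  have ex : x0 = u0 / s - z / (2 * s ^ 3) + δ := by rw [hδ]; ring
  have e1 : ∑ j ∈ J, q j * (u j / s) = (θ * u0 - A - q0 * u0) / s := by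
    rw [← hA]
    simp only [← mul_div_assoc, ← Finset.sum_div]
    ring
  have e2 : q0 * x0 + ∑ j ∈ J, q j * (u j / s) + (A + α / 2 * z) / s =
      θ * u0 / s - θ * (z / s ^ 2) / (2 * s) + q0 * δ := by
    rw [e1, ex, hq0]; field_simp; ring
  rw [e2]
  have hz' : |z / s ^ 2| ≤ R * τ := by
    rw [abs_div, abs_of_pos (show 0 < s ^ 2 by positivity), div_le_iff₀ (by positivity)]; exact hz
  have b1 : |θ * u0 / s| ≤ R ^ 2 * τ * e := by
    rw [div_eq_mul_one_div, abs_mul, abs_of_pos (show 0 < 1 / s by positivity)]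
    calc _ ≤ (R * (R * τ)) * e := by
          have := abs_mul_le' hθ hu0
          gcongr
      _ = _ := by ring
  have b2 : |θ * (z / s ^ 2) / (2 * s)| ≤ R ^ 2 * τ * e := by
    have : θ * (z / s ^ 2) / (2 * s) = θ * (z / s ^ 2) * (1 / 2 * (1 / s)) := by field_simp
    rw [this, abs_mul, abs_of_pos (show 0 < 1 / 2 * (1 / s) by positivity)]
    calc _ ≤ (R * (R * τ)) * e := by
          have := abs_mul_le' hθ hz'
          gcongr
          have : 0 < 1 / s := by positivity
          linarith
      _ = _ := by ring
  have b3 : |q0 * δ| ≤ 2 * R ^ 2 * τ * e := by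
    calc _ ≤ R * s ^ 2 * (2 * R * τ / s ^ 3) := abs_mul_le' hq1 hx
      _ = 2 * R ^ 2 * τ * (1 / s) := by field_simp
      _ ≤ _ := by gcongr
  calc _ ≤ |θ * u0 / s| + |θ * (z / s ^ 2) / (2 * s)| + |q0 * δ| :=
        (abs_add_le _ _).trans (add_le_add (abs_sub _ _) le_rfl)
    _ ≤ _ := by linarith

lemma second_order (J : Finset ℕ) (R α τ s x0 e u0 q0 : ℝ) (u q c : ℕ → ℝ) (hR : 1 ≤ R)
    (hJ : (J.card : ℝ) ≤ R) (hτ : 0 ≤ τ) (he0 : 0 ≤ e) (hs : 1 ≤ s)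
    (hx1 : |x0 - u0 / s| ≤ 3 * R * τ * e / s) (hx2 : |x0| ≤ 4 * R * τ / s)
    (hu0 : |u0| ≤ R * τ) (hu : ∀ j ∈ J, |u j| ≤ R * τ)
    (hq1 : |q0| ≤ R * s ^ 2)
    (hq0 : |q0 - α * s ^ 2| ≤ R * s ^ 2 * e)
    (hq : ∀ j ∈ J, |q j - c j * s ^ 2| ≤ R * s ^ 2 * e) :
    |q0 * x0 ^ 2 + ∑ j ∈ J, q j * (u j / s) ^ 2 - (α * u0 ^ 2 + ∑ j ∈ J, c j * u j ^ 2)| ≤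
      17 * R ^ 4 * τ ^ 2 * e := by
  have hs0 : 0 < s := by linarith
  have e1 : q0 * x0 ^ 2 + ∑ j ∈ J, q j * (u j / s) ^ 2 - (α * u0 ^ 2 + ∑ j ∈ J, c j * u j ^ 2) =
      q0 * ((x0 - u0 / s) * (x0 + u0 / s)) + (q0 - α * s ^ 2) * (u0 / s) ^ 2 +
      ∑ j ∈ J, (q j - c j * s ^ 2) * (u j / s) ^ 2 := by
    have : ∀ j, (q j - c j * s ^ 2) * (u j / s) ^ 2 = q j * (u j / s) ^ 2 - c j * u j ^ 2 := by
      intro j; field_simp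
    simp only [this, Finset.sum_sub_distrib]
    have : α * u0 ^ 2 = α * s ^ 2 * (u0 / s) ^ 2 := by field_simp
    rw [this]; ring
  have hus : ∀ v, |v| ≤ R * τ → |(v / s) ^ 2| ≤ (R * τ) ^ 2 / s ^ 2 := by
    intro v hv
    rw [abs_pow, abs_div, abs_of_pos hs0, div_pow]
    gcongr
  have b0 : ∀ v p, |v| ≤ R * τ → |p| ≤ R * s ^ 2 * e → |p * (v / s) ^ 2| ≤ R ^ 3 * τ ^ 2 * e := by
    intro v p hv hp
    calc _ ≤ R * s ^ 2 * e * ((R * τ) ^ 2 / s ^ 2) := abs_mul_le' hp (hus v hv)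
      _ = _ := by field_simp
  have b1 : |q0 * ((x0 - u0 / s) * (x0 + u0 / s))| ≤ 15 * R ^ 3 * τ ^ 2 * e := by
    have : |x0 + u0 / s| ≤ 5 * R * τ / s := by
      refine (abs_add_le _ _).trans ?_
      have : |u0 / s| ≤ R * τ / s := by rw [abs_div, abs_of_pos hs0]; gcongr
      calc _ ≤ 4 * R * τ / s + R * τ / s := add_le_add hx2 this
        _ = _ := by ring
    calc _ ≤ R * s ^ 2 * ((3 * R * τ * e / s) * (5 * R * τ / s)) :=
          abs_mul_le' hq1 (abs_mul_le' hx1 this)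
      _ = _ := by field_simp; ring
  have b3 : |∑ j ∈ J, (q j - c j * s ^ 2) * (u j / s) ^ 2| ≤ R ^ 4 * τ ^ 2 * e := by
    refine (Finset.abs_sum_le_sum_abs _ _).trans ?_
    refine (Finset.sum_le_card_nsmul J _ (R ^ 3 * τ ^ 2 * e) fun j hj => b0 _ _ (hu j hj) (hq j hj)).trans ?_
    rw [nsmul_eq_mul]
    calc _ ≤ R * (R ^ 3 * τ ^ 2 * e) := by gcongr
      _ = _ := by ring
  have hRR : R ^ 3 * τ ^ 2 * e ≤ R ^ 4 * τ ^ 2 * e := by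
    gcongr
    norm_num
  rw [e1]
  calc _ ≤ |q0 * ((x0 - u0 / s) * (x0 + u0 / s))| + |(q0 - α * s ^ 2) * (u0 / s) ^ 2| +
        |∑ j ∈ J, (q j - c j * s ^ 2) * (u j / s) ^ 2| :=
        (abs_add_le _ _).trans (add_le_add (abs_add_le _ _) le_rfl)
    _ ≤ 15 * R ^ 3 * τ ^ 2 * e + R ^ 3 * τ ^ 2 * e + R ^ 4 * τ ^ 2 * e :=
        add_le_add (add_le_add b1 (b0 _ _ hu0 hq0)) b3
    _ ≤ _ := by linarith

lemma third_order (J : Finset ℕ) (R τ s x0 u0 q0 : ℝ) (u q : ℕ → ℝ) (hR : 1 ≤ R)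
    (hJ : (J.card : ℝ) ≤ R) (hτ : 0 ≤ τ) (hs : 1 ≤ s)
    (hx2 : |x0| ≤ 4 * R * τ / s)
    (hu : ∀ j ∈ J, |u j| ≤ R * τ)
    (hq1 : |q0| ≤ R * s ^ 2)
    (hq : ∀ j ∈ J, |q j| ≤ R * s ^ 2) :
    ‖((q0 : ℂ) * (Complex.exp (Complex.I * x0) - 1) +
      ∑ j ∈ J, (q j : ℂ) * (Complex.exp (Complex.I * ((u j / s : ℝ) : ℂ)) - 1)) -
      (Complex.I * ((q0 * x0 + ∑ j ∈ J, q j * (u j / s) : ℝ) : ℂ) -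
        ((q0 * x0 ^ 2 + ∑ j ∈ J, q j * (u j / s) ^ 2 : ℝ) : ℂ) / 2)‖ ≤ 260 * R ^ 5 * τ ^ 3 / s := by
  have hs0 : 0 < s := by linarith
  have e1 : ((q0 : ℂ) * (Complex.exp (Complex.I * x0) - 1) +
      ∑ j ∈ J, (q j : ℂ) * (Complex.exp (Complex.I * ((u j / s : ℝ) : ℂ)) - 1)) -
      (Complex.I * ((q0 * x0 + ∑ j ∈ J, q j * (u j / s) : ℝ) : ℂ) -
        ((q0 * x0 ^ 2 + ∑ j ∈ J, q j * (u j / s) ^ 2 : ℝ) : ℂ) / 2) =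
      (q0 : ℂ) * (Complex.exp (Complex.I * x0) - 1 - Complex.I * x0 + x0 ^ 2 / 2) +
      ∑ j ∈ J, (q j : ℂ) * (Complex.exp (Complex.I * ((u j / s : ℝ) : ℂ)) - 1 -
        Complex.I * ((u j / s : ℝ) : ℂ) + ((u j / s : ℝ) : ℂ) ^ 2 / 2) := by
    simp only [mul_add, mul_sub, Finset.sum_add_distrib, Finset.sum_sub_distrib]
    push_cast
    simp only [mul_add, Finset.mul_sum, add_div, Finset.sum_div]
    have r1 : ∀ j, Complex.I * ((q j : ℂ) * ((u j : ℂ) / s)) = (q j : ℂ) * (Complex.I * ((u j : ℂ) / s)) :=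
      fun j => by ring
    have r2 : ∀ j, ((q j : ℂ) * ((u j : ℂ) / s) ^ 2) / 2 = (q j : ℂ) * (((u j : ℂ) / s) ^ 2 / 2) :=
      fun j => by ring
    simp only [r1, r2]
    ring
  have b0 : ∀ p x a, 0 ≤ a → |p| ≤ R * s ^ 2 → |x| ≤ a * R * τ / s →
      ‖(p : ℂ) * (Complex.exp (Complex.I * ((x : ℝ) : ℂ)) - 1 - Complex.I * x + x ^ 2 / 2)‖ ≤
       4 * a ^ 3 * R ^ 4 * τ ^ 3 / s := by
    intro p x a ha hp hx
    rw [norm_mul, Complex.norm_real, Real.norm_eq_abs]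
    calc _ ≤ R * s ^ 2 * (4 * (a * R * τ / s) ^ 3) := by
          gcongr
          refine (cexp3 x).trans ?_
          gcongr
      _ = _ := by field_simp
  rw [e1]
  refine (norm_add_le _ _).trans ?_
  have b1 := b0 q0 x0 4 (by norm_num) hq1 hx2
  have b2 : ‖∑ j ∈ J, (q j : ℂ) * (Complex.exp (Complex.I * ((u j / s : ℝ) : ℂ)) - 1 -
        Complex.I * ((u j / s : ℝ) : ℂ) + ((u j / s : ℝ) : ℂ) ^ 2 / 2)‖ ≤ R * (4 * R ^ 4 * τ ^ 3 / s) := by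
    refine (norm_sum_le _ _).trans ?_
    refine (Finset.sum_le_card_nsmul J _ (4 * R ^ 4 * τ ^ 3 / s) fun j hj => ?_).trans ?_
    · have := b0 (q j) (u j / s) 1 (by norm_num) (hq j hj) (by
        rw [abs_div, abs_of_pos hs0, one_mul]; have := hu j hj; gcongr)
      simpa using this
    · rw [nsmul_eq_mul]; gcongr
  have hRR : R ^ 4 * τ ^ 3 / s ≤ R ^ 5 * τ ^ 3 / s := by
    gcongr
    norm_num
  calc _ ≤ 4 * 4 ^ 3 * R ^ 4 * τ ^ 3 / s + R * (4 * R ^ 4 * τ ^ 3 / s) := add_le_add b1 b2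
    _ = 256 * (R ^ 4 * τ ^ 3 / s) + 4 * (R ^ 5 * τ ^ 3 / s) := by ring
    _ ≤ 256 * (R ^ 5 * τ ^ 3 / s) + 4 * (R ^ 5 * τ ^ 3 / s) := by gcongr
    _ = _ := by ring

set_option maxHeartbeats 2000000 in
lemma pt_est (J : Finset ℕ) (R α θ τ s s' N e z A u0 q0 : ℝ) (u q c : ℕ → ℝ) (hR : 1 ≤ R)
    (hJ : (J.card : ℝ) ≤ R) (hα0 : 0 ≤ α) (hα1 : α ≤ 1) (hθ : |θ| ≤ R) (hτ : 0 ≤ τ) (hτR : τ ≤ R)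
    (hs : 1 ≤ s) (hs' : s ≤ s') (h : s' ^ 2 = s ^ 2 + 1) (he : 1 / s ≤ e) (hN : 0 < N)
    (hsN : s ^ 2 ≤ 2 * N)
    (hu0 : |u0| ≤ R * τ) (hu : ∀ j ∈ J, |u j| ≤ R * τ)
    (hz : |z| ≤ R * τ * s ^ 2) (hze : |z| ≤ R * τ * s ^ 2 * e)
    (hA1 : |A| ≤ R * τ * s ^ 2) (hAe : |A| ≤ R * τ * s ^ 2 * e)
    (hq0 : q0 = α * s ^ 2 + θ) (hq1 : |q0| ≤ R * s ^ 2) (hq : ∀ j ∈ J, |q j| ≤ R * s ^ 2)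
    (hc : ∀ j ∈ J, 0 ≤ c j ∧ c j ≤ R)
    (hqc : ∀ j ∈ J, |q j - c j * s ^ 2| ≤ R * s ^ 2 * e)
    (hA : q0 * u0 + ∑ j ∈ J, q j * u j = θ * u0 - A) :
    ‖(((q0 / N : ℝ) : ℂ) * (Complex.exp (Complex.I * (((z + u0) / s' - z / s : ℝ) : ℂ)) - 1) +
      ∑ j ∈ J, ((q j / N : ℝ) : ℂ) * (Complex.exp (Complex.I * ((u j / s : ℝ) : ℂ)) - 1)) -
      (Complex.exp (Complex.I * ((-((A + α / 2 * z) / s / N) : ℝ) : ℂ)) *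
        ((1 - (α * u0 ^ 2 + ∑ j ∈ J, c j * u j ^ 2) / (2 * N) : ℝ) : ℂ) - 1)‖ ≤
      400 * R ^ 7 * τ * e / N := by
  have hs0 : 0 < s := by linarith
  have he0 : 0 < e := lt_of_lt_of_le (by positivity) he
  obtain ⟨hx1, hx2, hx3⟩ := x0_bounds R τ s s' e z u0 hR hτ hs hs' h he hu0 hz hze
  set x0 := (z + u0) / s' - z / s with hx0
  have F1 := first_order J R α θ τ s x0 e z A u0 q0 u q hR hτ hθ hs he hx1 hu0 hz hq0 hq1 hA
  have F2 := second_order J R α τ s x0 e u0 q0 u q c hR hJ hτ he0.le hs hx2 hx3 hu0 hu hq1 (by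
    rw [hq0, add_sub_cancel_left]
    refine hθ.trans ?_
    have : 1 ≤ s ^ 2 * e := by
      have : 1 ≤ s * e := by rw [div_le_iff₀ hs0] at he; linarith
      nlinarith
    nlinarith) hqc
  have F3 := third_order J R τ s x0 u0 q0 u q hR hJ hτ hs hx3 hu hq1 hq
  set Q := α * u0 ^ 2 + ∑ j ∈ J, c j * u j ^ 2 with hQ
  set L := q0 * x0 + ∑ j ∈ J, q j * (u j / s) with hL
  set P := q0 * x0 ^ 2 + ∑ j ∈ J, q j * (u j / s) ^ 2 with hP
  set τ' := (A + α / 2 * z) / s with hτ'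
  have hQ0 : 0 ≤ Q := by
    have : 0 ≤ ∑ j ∈ J, c j * u j ^ 2 := Finset.sum_nonneg fun j hj =>
      mul_nonneg (hc j hj).1 (sq_nonneg _)
    positivity
  have hQ1 : Q ≤ 2 * R ^ 4 * τ ^ 2 := by
    have a1 : ∀ v, |v| ≤ R * τ → v ^ 2 ≤ (R * τ) ^ 2 := fun v hv => by
      rw [← sq_abs]; gcongr
    have a2 : ∑ j ∈ J, c j * u j ^ 2 ≤ R * (R * (R * τ) ^ 2) := by
      refine (Finset.sum_le_card_nsmul J _ (R * (R * τ) ^ 2) fun j hj => ?_).trans ?_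
      · exact mul_le_mul (hc j hj).2 (a1 _ (hu j hj)) (sq_nonneg _) (by linarith)
      · rw [nsmul_eq_mul]; gcongr
    have a3 : α * u0 ^ 2 ≤ 1 * (R * τ) ^ 2 := by
      have := a1 _ hu0
      gcongr
    have a4 : (R * τ) ^ 2 ≤ R ^ 4 * τ ^ 2 := by
      rw [mul_pow]; gcongr
      norm_num
    calc Q ≤ 1 * (R * τ) ^ 2 + R * (R * (R * τ) ^ 2) := add_le_add a3 a2
      _ = (R * τ) ^ 2 + R ^ 4 * τ ^ 2 := by ring
      _ ≤ _ := by linarith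
  have hB : ∀ X, |A| ≤ X → |z| ≤ X → |A + α / 2 * z| ≤ 2 * X := by
    intro X h1 h2
    refine (abs_add_le _ _).trans ?_
    rw [abs_mul, abs_of_nonneg (by positivity : 0 ≤ α / 2)]
    have := abs_nonneg z
    nlinarith
  have hτ1 : |τ'| ≤ 2 * R * τ * s := by
    rw [hτ', abs_div, abs_of_pos hs0, div_le_iff₀ hs0]
    refine (hB _ hA1 hz).trans (le_of_eq (by ring))
  have hτ2 : |τ'| ≤ 2 * R * τ * s * e := by
    rw [hτ', abs_div, abs_of_pos hs0, div_le_iff₀ hs0]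
    refine (hB _ hAe hze).trans (le_of_eq (by ring))
  clear_value τ' P L Q
  have F4 := rhs_est (Q / (2 * N)) (τ' / N) (by positivity)
  set EE := Complex.exp (Complex.I * ((-(τ' / N) : ℝ) : ℂ)) * ((1 - Q / (2 * N) : ℝ) : ℂ) - 1 with hEE
  set SS := (q0 : ℂ) * (Complex.exp (Complex.I * x0) - 1) +
      ∑ j ∈ J, (q j : ℂ) * (Complex.exp (Complex.I * ((u j / s : ℝ) : ℂ)) - 1) with hSS
  have hNC : (N : ℂ) ≠ 0 := by exact_mod_cast hN.ne'
  have eS : ((q0 / N : ℝ) : ℂ) * (Complex.exp (Complex.I * x0) - 1) +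
      ∑ j ∈ J, ((q j / N : ℝ) : ℂ) * (Complex.exp (Complex.I * ((u j / s : ℝ) : ℂ)) - 1) = SS / N := by
    rw [hSS, add_div, Finset.sum_div]
    congr 1
    · push_cast; ring
    · refine Finset.sum_congr rfl fun j _ => ?_
      push_cast; ring
  rw [eS]
  have eD : SS / N - EE = ((SS - (Complex.I * (L : ℂ) - (P : ℂ) / 2)) + (Complex.I * ((L + τ' : ℝ) : ℂ)
      - ((P - Q : ℝ) : ℂ) / 2)) / N - (EE - (-Complex.I * ((τ' / N : ℝ) : ℂ) - ((Q / (2 * N) : ℝ) : ℂ))) := by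
    push_cast; field_simp; ring
  rw [eD]
  have hs1 : 1 / s ≤ 1 := by rw [div_le_one hs0]; exact hs
  have hττ : τ ^ 2 ≤ R * τ := by rw [sq]; gcongr
  have hτττ : τ ^ 3 ≤ R ^ 2 * τ := by
    calc τ ^ 3 = τ ^ 2 * τ := by ring
      _ ≤ R ^ 2 * τ := by gcongr
  have c1 : 260 * R ^ 5 * τ ^ 3 / s ≤ 260 * R ^ 7 * τ * e := by
    calc 260 * R ^ 5 * τ ^ 3 / s = 260 * R ^ 5 * τ ^ 3 * (1 / s) := by ring
      _ ≤ 260 * R ^ 5 * (R ^ 2 * τ) * e := by gcongr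
      _ = _ := by ring
  have hRp : ∀ i, i ≤ 7 → R ^ i ≤ R ^ 7 := fun i hi => pow_le_pow_right₀ hR hi
  have c2 : 4 * R ^ 2 * τ * e ≤ 4 * R ^ 7 * τ * e := by
    have := hRp 2 (by norm_num)
    gcongr
  have c3 : 17 * R ^ 4 * τ ^ 2 * e ≤ 17 * R ^ 7 * τ * e := by
    calc _ ≤ 17 * R ^ 4 * (R * τ) * e := by gcongr
      _ = 17 * R ^ 5 * τ * e := by ring
      _ ≤ _ := by gcongr; norm_num
  have c4 : 3 * (τ' / N) ^ 2 ≤ 24 * R ^ 7 * τ * e / N := by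
    have : τ' ^ 2 ≤ 8 * R ^ 3 * τ * e * N := by
      calc τ' ^ 2 = |τ'| * |τ'| := by rw [← sq, sq_abs]
        _ ≤ (2 * R * τ * s) * (2 * R * τ * s * e) := mul_le_mul hτ1 hτ2 (abs_nonneg _) (by positivity)
        _ = 4 * R ^ 2 * τ ^ 2 * e * s ^ 2 := by ring
        _ ≤ 4 * R ^ 2 * (R * τ) * e * (2 * N) := by gcongr
        _ = _ := by ring
    calc 3 * (τ' / N) ^ 2 = 3 * τ' ^ 2 / N ^ 2 := by ring
      _ ≤ 3 * (8 * R ^ 3 * τ * e * N) / N ^ 2 := by gcongr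
      _ = 24 * R ^ 3 * τ * e / N := by field_simp; ring
      _ ≤ _ := by gcongr; norm_num
  have c5 : Q / (2 * N) * |τ' / N| ≤ 4 * R ^ 7 * τ * e / N := by
    have : s / N ≤ 2 * e := by
      rw [div_le_iff₀ hN]
      have : 1 ≤ s * e := by rw [div_le_iff₀ hs0] at he; linarith
      have h2 : s * 1 ≤ s * (s * e) := by gcongr
      calc s ≤ s ^ 2 * e := by linarith
        _ ≤ 2 * N * e := by gcongr
        _ = _ := by ring
    rw [abs_div, abs_of_pos hN]
    calc Q / (2 * N) * (|τ'| / N) ≤ (2 * R ^ 4 * τ ^ 2) / (2 * N) * (2 * R * τ * s / N) := by gcongr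
      _ = 2 * R ^ 5 * τ ^ 3 * (s / N) / N := by field_simp
      _ ≤ 2 * R ^ 5 * (R ^ 2 * τ) * (2 * e) / N := by gcongr
      _ = _ := by ring
  have d1 : ‖((SS - (Complex.I * (L : ℂ) - (P : ℂ) / 2)) + (Complex.I * ((L + τ' : ℝ) : ℂ)
      - ((P - Q : ℝ) : ℂ) / 2)) / N‖ ≤ (260 * R ^ 7 * τ * e + (4 * R ^ 7 * τ * e + 17 * R ^ 7 * τ * e)) / N := by
    rw [norm_div, Complex.norm_real, Real.norm_of_nonneg hN.le]
    gcongr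
    refine (norm_add_le _ _).trans (add_le_add (F3.trans c1) ?_)
    refine (norm_sub_le _ _).trans (add_le_add ?_ ?_)
    · rw [norm_mul, Complex.norm_I, one_mul, Complex.norm_real]
      exact F1.trans c2
    · rw [norm_div, Complex.norm_real, Complex.norm_ofNat, Real.norm_eq_abs]
      have := F2.trans c3
      have := abs_nonneg (P - Q)
      linarith
  refine (norm_sub_le _ _).trans ((add_le_add d1 (F4.trans (add_le_add c4 c5))).trans ?_)
  have : 0 ≤ R ^ 7 * τ * e / N := by positivity
  calc _ = 309 * (R ^ 7 * τ * e / N) := by ring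
    _ ≤ 400 * (R ^ 7 * τ * e / N) := by gcongr; norm_num
    _ = _ := by ring


def bt (α : ℝ) (d : ℕ) (t : ℕ → ℝ) (i : ℕ) : ℝ := ∑ r ∈ Finset.Icc 1 d, t r * cH α r i

def ph {Ω : Type*} {mΩ : MeasurableSpace Ω} (μ : Measure Ω) (α : ℝ) (d : ℕ) (K : ℕ → Ω → ℕ)
    (B : ℕ → ℕ → Ω → ℕ) (n : ℕ) (t : ℕ → ℝ) : ℂ :=
  ∫ ω, Complex.exp (Complex.I * ((zz (bt α d t) d K B n ω / √(K n ω : ℝ) : ℝ) : ℂ)) ∂μ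

def QQ (α : ℝ) (d : ℕ) (t : ℕ → ℝ) : ℝ := α * (bt α d t 1 - bt α d t 0) ^ 2 +
  ∑ j ∈ Finset.Icc 1 d, (((j : ℝ) - α) * sibuya α j) * (bt α d t (j + 1) - bt α d t j) ^ 2

def sh (α N : ℝ) (t : ℕ → ℝ) (r : ℕ) : ℝ := t r * (1 - ((r : ℝ) - α / 2) / N)

lemma zz_bt {Ω : Type*} (α : ℝ) (d : ℕ) (K : ℕ → Ω → ℕ)
    (B : ℕ → ℕ → Ω → ℕ) (n : ℕ) (t : ℕ → ℝ) (ω : Ω) :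
    zz (bt α d t) d K B n ω = ∑ r ∈ Finset.Icc 1 d, t r * zz (cH α r) d K B n ω := by
  simp only [zz, bt, mul_sub, Finset.sum_sub_distrib, Finset.sum_mul, Finset.mul_sum]
  rw [Finset.sum_comm]
  simp only [mul_assoc]

lemma bt_top (α : ℝ) (d : ℕ) (t : ℕ → ℝ) : bt α d t (d + 1) = 0 := by
  refine Finset.sum_eq_zero fun r hr => ?_
  have := (Finset.mem_Icc.1 hr).2
  have : ¬ d + 1 ≤ r := by omega
  simp [cH, this]

lemma sum_abs_le (d : ℕ) (t v : ℕ → ℝ) (τ : ℝ) (ht : ∀ r ∈ Finset.Icc 1 d, |t r| ≤ τ) :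
    |∑ r ∈ Finset.Icc 1 d, t r * v r| ≤ τ * ∑ r ∈ Finset.Icc 1 d, |v r| := by
  refine (Finset.abs_sum_le_sum_abs _ _).trans ?_
  rw [Finset.mul_sum]
  refine Finset.sum_le_sum fun r hr => ?_
  rw [abs_mul]
  exact mul_le_mul_of_nonneg_right (ht r hr) (abs_nonneg _)

lemma exp_split (q0 N x0 y : ℝ) : (q0 / N : ℝ) • (Complex.exp (Complex.I * ((x0 : ℝ) : ℂ)) - Complex.exp (Complex.I * ((y : ℝ) : ℂ)))
    = Complex.exp (Complex.I * ((y : ℝ) : ℂ)) * (((q0 / N : ℝ) : ℂ) * (Complex.exp (Complex.I * ((x0 - y : ℝ) : ℂ)) - 1)) := by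
  rw [Complex.real_smul]
  have : Complex.exp (Complex.I * ((x0 : ℝ) : ℂ)) = Complex.exp (Complex.I * ((y : ℝ) : ℂ)) * Complex.exp (Complex.I * ((x0 - y : ℝ) : ℂ)) := by
    rw [← Complex.exp_add]; congr 1; push_cast; ring
  rw [this]; ring

lemma pt_all (α θ T : ℝ) (hα0 : 0 < α) (hα1 : α < 1) (d : ℕ) :
    ∃ R, 1 ≤ R ∧ ∀ (k N e τ : ℝ) (t bv V : ℕ → ℝ), 1 ≤ k → 0 < N → k ≤ 2 * N → 0 ≤ τ → τ ≤ T →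
    (∀ r ∈ Finset.Icc 1 d, |t r| ≤ τ) → (∀ i ∈ Finset.Icc 1 d, 0 ≤ bv i ∧ bv i ≤ k) →
    (∀ r, V r = ∑ i ∈ Finset.Icc 1 d, cH α r i * bv i - cH α r 0 * k) →
    (∀ r, |V r| ≤ bb (cH α r) d * k) → 1 / √k ≤ e → ∑ r ∈ Finset.Icc 1 d, |V r / k| ≤ e →
    (∀ i ∈ Finset.Icc 1 d, |bv i / k - sibuya α i| ≤ e) →
    ‖((((α * k + θ) / N : ℝ) : ℂ) * (Complex.exp (Complex.I * (((∑ r ∈ Finset.Icc 1 d, t r * V r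
      + (bt α d t 1 - bt α d t 0)) / √(k + 1) - (∑ r ∈ Finset.Icc 1 d, t r * V r) / √k : ℝ) : ℂ)) - 1) +
      ∑ j ∈ Finset.Icc 1 d, (((((j : ℝ) - α) * bv j) / N : ℝ) : ℂ) *
        (Complex.exp (Complex.I * (((bt α d t (j + 1) - bt α d t j) / √k : ℝ) : ℂ)) - 1)) -
      (Complex.exp (Complex.I * ((-((∑ r ∈ Finset.Icc 1 d, t r * (((r : ℝ) - α) * V r) +
          α / 2 * ∑ r ∈ Finset.Icc 1 d, t r * V r) / √k / N) : ℝ) : ℂ)) *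
        ((1 - QQ α d t / (2 * N) : ℝ) : ℂ) - 1)‖ ≤
      400 * R ^ 7 * τ * e / N := by
  obtain ⟨M, hM0, hM⟩ : ∃ M : ℝ, 0 ≤ M ∧ ∀ j ≤ d, ∑ r ∈ Finset.Icc 1 d, |cH α r (j + 1) - cH α r j| ≤ M :=
    ⟨∑ j ∈ Finset.range (d + 1), ∑ r ∈ Finset.Icc 1 d, |cH α r (j + 1) - cH α r j|, by positivity,
      fun j hj => Finset.single_le_sum
      (f := fun j => ∑ r ∈ Finset.Icc 1 d, |cH α r (j + 1) - cH α r j|)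
      (fun i _ => by positivity) (Finset.mem_range.2 (by omega))⟩
  obtain ⟨b, hb0, hb⟩ : ∃ b : ℝ, 0 ≤ b ∧ ∑ r ∈ Finset.Icc 1 d, bb (cH α r) d = b :=
    ⟨_, Finset.sum_nonneg fun r _ => bb_nonneg _ _, rfl⟩
  obtain ⟨S, hS0, hS⟩ : ∃ S : ℝ, 0 ≤ S ∧ ∀ j ∈ Finset.Icc 1 d, |((j : ℝ) - α) * sibuya α j| ≤ S :=
    ⟨∑ j ∈ Finset.Icc 1 d, |((j : ℝ) - α) * sibuya α j|, by positivity, fun j hj =>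
      Finset.single_le_sum (f := fun j : ℕ => |((j : ℝ) - α) * sibuya α j|)
        (fun i _ => abs_nonneg _) hj⟩
  have hdd : (0 : ℝ) ≤ d := by positivity
  obtain ⟨R, hR, hRθ, hRT, hRd, hRM, hRb, hRdb, hRS⟩ : ∃ R : ℝ, 1 ≤ R ∧ 1 + |θ| ≤ R ∧ T ≤ R ∧ d ≤ R ∧
      M ≤ R ∧ b ≤ R ∧ d * b ≤ R ∧ S ≤ R := by
    have hθ0 := abs_nonneg θ
    have hT0 := abs_nonneg T
    have hT1 := le_abs_self T
    have hdb : 0 ≤ d * b := by positivity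
    refine ⟨1 + |θ| + |T| + d + M + b + d * b + S, ?_, ?_, ?_, ?_, ?_, ?_, ?_, ?_⟩ <;> linarith
  refine ⟨R, hR, ?_⟩
  intro k N e τ t bv V hk hN hkN hτ0 hτT ht hbv hV hVk he1 he2 he3
  have hk0 : 0 < k := by linarith
  have hs : 1 ≤ √k := by rwa [Real.one_le_sqrt]
  have hsq : √k ^ 2 = k := Real.sq_sqrt (by positivity)
  have hsq' : √(k + 1) ^ 2 = k + 1 := Real.sq_sqrt (by positivity)
  have hss : √k ≤ √(k + 1) := Real.sqrt_le_sqrt (by linarith)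
  have hs0 : 0 < 1 / √k := by positivity
  have he0 : 0 ≤ e := by linarith
  have eV : ∑ r ∈ Finset.Icc 1 d, |V r| = k * ∑ r ∈ Finset.Icc 1 d, |V r / k| := by
    rw [Finset.mul_sum]
    refine Finset.sum_congr rfl fun r _ => ?_
    rw [abs_div, abs_of_pos hk0]; field_simp
  have hVb : ∑ r ∈ Finset.Icc 1 d, |V r| ≤ b * k := by
    rw [← hb, Finset.sum_mul]
    exact Finset.sum_le_sum fun r _ => hVk r
  have hVe : ∑ r ∈ Finset.Icc 1 d, |V r| ≤ k * e := by rw [eV]; gcongr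
  have hu : ∀ j ≤ d, |bt α d t (j + 1) - bt α d t j| ≤ R * τ := by
    intro j hj
    have : bt α d t (j + 1) - bt α d t j = ∑ r ∈ Finset.Icc 1 d, t r * (cH α r (j + 1) - cH α r j) := by
      simp only [bt, mul_sub, Finset.sum_sub_distrib]
    rw [this]
    refine (sum_abs_le d t _ τ ht).trans ?_
    have := (hM j hj).trans hRM
    rw [mul_comm]; gcongr
  have hAV : ∑ r ∈ Finset.Icc 1 d, |((r : ℝ) - α) * V r| ≤ d * ∑ r ∈ Finset.Icc 1 d, |V r| := by
    rw [Finset.mul_sum]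
    refine Finset.sum_le_sum fun r hr => ?_
    obtain ⟨a, c⟩ := Finset.mem_Icc.1 hr
    have a' : (1 : ℝ) ≤ r := by exact_mod_cast a
    have c' : (r : ℝ) ≤ d := by exact_mod_cast c
    rw [abs_mul, abs_of_nonneg (show 0 ≤ (r : ℝ) - α by linarith)]
    gcongr; linarith
  have hAle := sum_abs_le d t (fun r => ((r : ℝ) - α) * V r) τ ht
  have hzle := sum_abs_le d t V τ ht
  have hdrift : (α * k + θ) * (bt α d t 1 - bt α d t 0) + ∑ j ∈ Finset.Icc 1 d,
      ((j : ℝ) - α) * bv j * (bt α d t (j + 1) - bt α d t j) = θ * (bt α d t 1 - bt α d t 0) -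
        ∑ r ∈ Finset.Icc 1 d, t r * (((r : ℝ) - α) * V r) := by
    have d1 : ∀ j : ℕ, ((j : ℝ) - α) * (bt α d t (j + 1) - bt α d t j) =
        ∑ r ∈ Finset.Icc 1 d, t r * (-((r : ℝ) - α) * cH α r j) := by
      intro j
      simp only [← cH_drift, bt, ← Finset.sum_sub_distrib, Finset.mul_sum]
      exact Finset.sum_congr rfl fun r _ => by ring
    have d2 : ∑ j ∈ Finset.Icc 1 d, ((j : ℝ) - α) * bv j * (bt α d t (j + 1) - bt α d t j)
        = ∑ r ∈ Finset.Icc 1 d, t r * (-((r : ℝ) - α) *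
          ∑ j ∈ Finset.Icc 1 d, cH α r j * bv j) := by
      have : ∀ j : ℕ, ((j : ℝ) - α) * bv j * (bt α d t (j + 1) - bt α d t j) =
        ∑ r ∈ Finset.Icc 1 d, t r * (-((r : ℝ) - α) * (cH α r j * bv j)) := by
        intro j
        have := d1 j
        calc _ = bv j * (((j : ℝ) - α) * (bt α d t (j + 1) - bt α d t j)) := by ring
          _ = _ := by
            rw [this, Finset.mul_sum]
            exact Finset.sum_congr rfl fun r _ => by ring
      simp only [this]
      rw [Finset.sum_comm]
      simp only [Finset.mul_sum]
    have d3 : ∑ r ∈ Finset.Icc 1 d, t r * (((r : ℝ) - α) * V r) =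
        -(∑ r ∈ Finset.Icc 1 d, t r * (-((r : ℝ) - α) *
          ∑ j ∈ Finset.Icc 1 d, cH α r j * bv j)) +
          k * ∑ r ∈ Finset.Icc 1 d, t r * (-((r : ℝ) - α) * cH α r 0) := by
      rw [Finset.mul_sum, ← Finset.sum_neg_distrib, ← Finset.sum_add_distrib]
      refine Finset.sum_congr rfl fun r _ => ?_
      rw [hV r]
      ring
    rw [d2, d3, ← d1 0]
    push_cast
    ring
  have hQQ : QQ α d t = α * (bt α d t 1 - bt α d t 0) ^ 2 +
    ∑ j ∈ Finset.Icc 1 d, (((j : ℝ) - α) * sibuya α j) * (bt α d t (j + 1) - bt α d t j) ^ 2 := rfl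
  rw [hQQ]
  generalize ∑ r ∈ Finset.Icc 1 d, t r * (((r : ℝ) - α) * V r) = A at *
  generalize ∑ r ∈ Finset.Icc 1 d, t r * V r = z at *
  refine pt_est (Finset.Icc 1 d) R α θ τ (√k) (√(k + 1)) N e z A (bt α d t 1 - bt α d t 0) (α * k + θ)
    (fun j => bt α d t (j + 1) - bt α d t j) (fun j => ((j : ℝ) - α) * bv j)
    (fun j => ((j : ℝ) - α) * sibuya α j) hR (by simpa using hRd) hα0.le hα1.le (by linarith) hτ0
    (hτT.trans hRT) hs hss (by rw [hsq, hsq']) he1 hN (by rwa [hsq])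
    (hu 0 (by omega)) (fun j hj => hu j (Finset.mem_Icc.1 hj).2) ?_ ?_ ?_ ?_ (by rw [hsq]) ?_ ?_ ?_ ?_ hdrift
  · rw [hsq]
    calc _ ≤ τ * (b * k) := hzle.trans (by gcongr)
      _ = b * τ * k := by ring
      _ ≤ _ := by gcongr
  · rw [hsq]
    calc _ ≤ τ * (k * e) := hzle.trans (by gcongr)
      _ = 1 * τ * k * e := by ring
      _ ≤ _ := by gcongr
  · rw [hsq]
    calc _ ≤ τ * (d * (b * k)) := hAle.trans (by gcongr; exact hAV.trans (by gcongr))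
      _ = (d * b) * τ * k := by ring
      _ ≤ _ := by gcongr
  · rw [hsq]
    calc _ ≤ τ * (d * (k * e)) := hAle.trans (by gcongr; exact hAV.trans (by gcongr))
      _ = d * τ * k * e := by ring
      _ ≤ _ := by gcongr
  · rw [hsq]
    refine (abs_add_le _ _).trans ?_
    rw [abs_of_pos (show 0 < α * k by positivity)]
    calc α * k + |θ| ≤ 1 * k + |θ| * k := by
          have : |θ| * 1 ≤ |θ| * k := by gcongr
          have : α * k ≤ 1 * k := by gcongr
          linarith
      _ = (1 + |θ|) * k := by ring
      _ ≤ _ := by gcongr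
  · intro j hj
    obtain ⟨a, c⟩ := Finset.mem_Icc.1 hj
    have a' : (1 : ℝ) ≤ j := by exact_mod_cast a
    have c' : (j : ℝ) ≤ d := by exact_mod_cast c
    rw [hsq]
    refine abs_mul_le' ?_ ?_
    · rw [abs_of_nonneg (by linarith)]; linarith
    · rw [abs_of_nonneg (hbv j hj).1]; exact (hbv j hj).2
  · intro j hj
    obtain ⟨a, c⟩ := Finset.mem_Icc.1 hj
    have a' : (1 : ℝ) ≤ j := by exact_mod_cast a
    refine ⟨mul_nonneg (by linarith) (sibuya_pos α hα0 hα1 j).le, ?_⟩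
    exact (le_abs_self _).trans ((hS j hj).trans hRS)
  · intro j hj
    obtain ⟨a, c⟩ := Finset.mem_Icc.1 hj
    have a' : (1 : ℝ) ≤ j := by exact_mod_cast a
    have c' : (j : ℝ) ≤ d := by exact_mod_cast c
    rw [hsq]
    have : ((j : ℝ) - α) * bv j - ((j : ℝ) - α) * sibuya α j * k =
      (((j : ℝ) - α) * k) * (bv j / k - sibuya α j) := by field_simp
    simp only [this]
    refine abs_mul_le' ?_ (he3 j hj)
    rw [abs_mul, abs_of_pos hk0, abs_of_nonneg (by linarith)]
    gcongr; linarith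



lemma int_combine {Ω : Type*} {mΩ : MeasurableSpace Ω} {μ : Measure Ω} {f g h : Ω → ℂ} {E : Ω → ℝ}
    (hf : Integrable f μ) (hg : Integrable g μ) (hh : Integrable h μ) (hE : Integrable E μ) (c : ℂ)
    (hle : ∀ᵐ ω ∂μ, ‖f ω + g ω - c * h ω‖ ≤ E ω) :
    ‖∫ ω, f ω ∂μ + ∫ ω, g ω ∂μ - c * ∫ ω, h ω ∂μ‖ ≤ ∫ ω, E ω ∂μ := by
  rw [← integral_add hf hg, ← integral_const_mul,
    ← integral_sub (show Integrable (fun ω => f ω + g ω) μ from hf.add hg) (hh.const_mul _)]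
  exact norm_integral_le_of_norm_le hE hle

section recursion
variable {α θ : ℝ} {Ω : Type*} {mΩ : MeasurableSpace Ω} {μ : Measure Ω} {F : Filtration ℕ mΩ}
  {K : ℕ → Ω → ℕ} {B : ℕ → ℕ → Ω → ℕ}

lemma ph_rec (hEP : IsEwensPitman α θ μ F K B) (hα0 : 0 < α) (hα1 : α < 1)
    (hθ : 0 < α + θ) (d : ℕ) (hd : 1 ≤ d) (T : ℝ) : ∃ C, 0 ≤ C ∧ ∀ᶠ n : ℕ in atTop,
    ∀ t τ, 0 ≤ τ → τ ≤ T → (∀ r ∈ Finset.Icc 1 d, |t r| ≤ τ) →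
    ‖ph μ α d K B (n + 1) t - ((1 - QQ α d t / (2 * ((n : ℝ) + θ)) : ℝ) : ℂ) *
      ph μ α d K B n (sh α (n + θ) t)‖ ≤ C * τ * (∫ ω, err α d K B n ω ∂μ) / (n + θ) := by
  have hprob := hEP.prob
  obtain ⟨R, hR, hpt⟩ := pt_all α θ T hα0 hα1 d
  refine ⟨400 * R ^ 7, by positivity, ?_⟩
  filter_upwards [eventually_ge_atTop 1, eventually_ge_atTop (⌈2 * |θ|⌉₊)] with n hn hn2 t τ hτ0 hτT ht
  have hn' : (1 : ℝ) ≤ n := by exact_mod_cast hn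
  have hN : 0 < (n : ℝ) + θ := by linarith
  have hn2 : 2 * |θ| ≤ n := Nat.ceil_le.1 hn2
  set N := (n : ℝ) + θ with hNdef
  have hnN : (n : ℝ) ≤ 2 * N := by have := neg_abs_le θ; linarith
  obtain ⟨h1, h2, h3⟩ := transition hEP (E := ℂ) hα1 hθ n hn hd (β := bt α d t) (bt_top α d t)
    (g := fun k z => Complex.exp (Complex.I * ((z / √(k : ℝ) : ℝ) : ℂ)))
    (fun k => by fun_prop) (fun k z => by
      rw [mul_comm, Complex.norm_exp_ofReal_mul_I]; nlinarith [sq_nonneg z])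
  have h1 := h1 n hn
  have h1' : Integrable (fun ω => Complex.exp (Complex.I *
      ((zz (bt α d (sh α N t)) d K B n ω / √(K n ω : ℝ) : ℝ) : ℂ))) μ := by
    refine Integrable.of_bound (C := 1) ?_ (Eventually.of_forall fun ω => ?_)
    · have m1 := meas_zz' hEP (bt α d (sh α N t)) d n
      have m2 := meas_K' hEP n
      exact (Complex.measurable_exp.comp (measurable_const.mul
        (Complex.measurable_ofReal.comp (m1.div m2.sqrt)))).aestronglyMeasurable
    · rw [mul_comm, Complex.norm_exp_ofReal_mul_I]
  unfold ph
  rw [h3]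
  have hrhs : 400 * R ^ 7 * τ * (∫ ω, err α d K B n ω ∂μ) / N =
      ∫ ω, 400 * R ^ 7 * τ / N * err α d K B n ω ∂μ := by
    rw [integral_const_mul]; ring
  rw [hrhs]
  refine int_combine h1 h2 h1' ((err_int hEP d n hn).const_mul _) _ ?_
  have hzall : ∀ᵐ ω ∂μ, ∀ r, |zz (cH α r) d K B n ω| ≤ bb (cH α r) d * K n ω :=
    ae_all_iff.2 fun r => zz_bound hEP (cH α r) d n hn
  filter_upwards [ep_basic hEP n hn, hzall] with ω hω hz
  have hK : (1 : ℝ) ≤ K n ω := by exact_mod_cast hω.1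
  have hKn : (K n ω : ℝ) ≤ n := by exact_mod_cast hω.2.1
  have e1 : 1 / √(K n ω : ℝ) ≤ err α d K B n ω := by
    rw [err]
    have : 0 ≤ ∑ i ∈ Finset.Icc 1 d, |(B i n ω : ℝ) / (K n ω : ℝ) - sibuya α i| := by positivity
    have : 0 ≤ ∑ r ∈ Finset.Icc 1 d, |zz (cH α r) d K B n ω / (K n ω : ℝ)| := by positivity
    linarith
  have e2 : ∑ r ∈ Finset.Icc 1 d, |zz (cH α r) d K B n ω / (K n ω : ℝ)| ≤ err α d K B n ω := by
    rw [err]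
    have : 0 ≤ ∑ i ∈ Finset.Icc 1 d, |(B i n ω : ℝ) / (K n ω : ℝ) - sibuya α i| := by positivity
    have : 0 < 1 / √(K n ω : ℝ) := by positivity
    linarith
  have e3 : ∀ i ∈ Finset.Icc 1 d, |(B i n ω : ℝ) / (K n ω : ℝ) - sibuya α i| ≤ err α d K B n ω := by
    intro i hi
    rw [err]
    have h1 : |(B i n ω : ℝ) / (K n ω : ℝ) - sibuya α i| ≤ _ :=
      Finset.single_le_sum (f := fun i => |(B i n ω : ℝ) / (K n ω : ℝ) - sibuya α i|)
      (fun i _ => abs_nonneg _) hi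
    have : 0 ≤ ∑ r ∈ Finset.Icc 1 d, |zz (cH α r) d K B n ω / (K n ω : ℝ)| := by positivity
    have : 0 < 1 / √(K n ω : ℝ) := by positivity
    linarith
  have key := hpt (K n ω) N (err α d K B n ω) τ t (fun j => (B j n ω : ℝ))
    (fun r => zz (cH α r) d K B n ω) hK hN (hKn.trans hnN) hτ0 hτT ht
    (fun i hi => ⟨by positivity, by exact_mod_cast hω.2.2 i (Finset.mem_Icc.1 hi).1⟩)
    (fun r => rfl) hz e1 e2 e3
  have hphase : zz (bt α d t) d K B n ω / √(K n ω : ℝ) + -((∑ r ∈ Finset.Icc 1 d, t r * (((r : ℝ) - α) *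
      zz (cH α r) d K B n ω) + α / 2 * zz (bt α d t) d K B n ω) / √(K n ω : ℝ) / N) =
      zz (bt α d (sh α N t)) d K B n ω / √(K n ω : ℝ) := by
    rw [zz_bt, zz_bt]
    have : ∑ r ∈ Finset.Icc 1 d, sh α N t r * zz (cH α r) d K B n ω =
      ∑ r ∈ Finset.Icc 1 d, t r * zz (cH α r) d K B n ω -
      (∑ r ∈ Finset.Icc 1 d, t r * (((r : ℝ) - α) * zz (cH α r) d K B n ω) +
        α / 2 * ∑ r ∈ Finset.Icc 1 d, t r * zz (cH α r) d K B n ω) / N := by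
      rw [Finset.mul_sum, ← Finset.sum_add_distrib, Finset.sum_div, ← Finset.sum_sub_distrib]
      refine Finset.sum_congr rfl fun r _ => ?_
      simp only [sh]; ring
    rw [this]; ring
  rw [← zz_bt] at key
  generalize ∑ r ∈ Finset.Icc 1 d, t r * (((r : ℝ) - α) * zz (cH α r) d K B n ω) = A at key hphase
  simp only [← hNdef]
  simp only [exp_split]
  rw [← hphase]
  generalize zz (bt α d t) d K B n ω = z at key ⊢
  have hsub : ∀ v : ℝ, (z + v) / √(K n ω : ℝ) - z / √(K n ω : ℝ) = v / √(K n ω : ℝ) := fun v => by ring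
  simp only [hsub]
  push_cast at key ⊢
  rw [← Finset.mul_sum, mul_add Complex.I, Complex.exp_add]
  set W := Complex.exp (Complex.I * ((z : ℂ) / (√(K n ω : ℝ) : ℂ))) with hW
  have hWn : ‖W‖ = 1 := by
    rw [hW, mul_comm]
    exact_mod_cast Complex.norm_exp_ofReal_mul_I (z / √(K n ω : ℝ))
  have hfin : ∀ a b c f : ℂ, W + (W * a + W * b) - c * (W * f) = W * ((a + b) - (f * c - 1)) := by
    intro a b c f; ring
  rw [hfin, norm_mul, hWn, one_mul]
  refine key.trans (le_of_eq ?_)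
  ring

end recursion



def LL (α : ℝ) (d : ℕ) (t : ℕ → ℝ) : ℝ :=
  ∑ r ∈ Finset.Icc 1 d, ∑ s ∈ Finset.Icc 1 d, t r * t s * lambdaEntry α r s

lemma quad_bound (d : ℕ) (c : ℕ → ℕ → ℝ) (t : ℕ → ℝ) (τ : ℝ) (hτ : 0 ≤ τ)
    (ht : ∀ r ∈ Finset.Icc 1 d, |t r| ≤ τ) :
    |∑ r ∈ Finset.Icc 1 d, ∑ s ∈ Finset.Icc 1 d, t r * t s * c r s| ≤
      (∑ r ∈ Finset.Icc 1 d, ∑ s ∈ Finset.Icc 1 d, |c r s|) * τ ^ 2 := by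
  refine (Finset.abs_sum_le_sum_abs _ _).trans ?_
  rw [Finset.sum_mul]
  refine Finset.sum_le_sum fun r hr => ?_
  refine (Finset.abs_sum_le_sum_abs _ _).trans ?_
  rw [Finset.sum_mul]
  refine Finset.sum_le_sum fun s hs => ?_
  rw [abs_mul, abs_mul, mul_comm, sq]
  gcongr
  · exact ht r hr
  · exact ht s hs

lemma QQ_eq (α : ℝ) (d : ℕ) (t : ℕ → ℝ) :
    QQ α d t = ∑ r ∈ Finset.Icc 1 d, ∑ s ∈ Finset.Icc 1 d,
      t r * t s * (((r : ℝ) + s - α) * lambdaEntry α r s) := by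
  have h : ∀ r ∈ Finset.Icc 1 d, ∀ s ∈ Finset.Icc 1 d,
      t r * t s * (((r : ℝ) + s - α) * lambdaEntry α r s) =
      α * ((t r * (cH α r 1 - cH α r 0)) * (t s * (cH α s 1 - cH α s 0))) +
      ∑ j ∈ Finset.Icc 1 d, ((j : ℝ) - α) * sibuya α j * ((t r * (cH α r (j + 1) - cH α r j))
          * (t s * (cH α s (j + 1) - cH α s j))) := by
    intro r hr s hs
    rw [← sigma_id α d r s (Finset.mem_Icc.1 hr).1 (Finset.mem_Icc.1 hr).2, mul_add, Finset.mul_sum]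
    congr 1
    · ring
    · exact Finset.sum_congr rfl fun j _ => by ring
  rw [Finset.sum_congr rfl fun r hr => Finset.sum_congr rfl fun s hs => h r hr s hs]
  simp only [Finset.sum_add_distrib]
  have hb : ∀ j, bt α d t (j + 1) - bt α d t j =
      ∑ r ∈ Finset.Icc 1 d, t r * (cH α r (j + 1) - cH α r j) := by
    intro j; simp only [bt, mul_sub, Finset.sum_sub_distrib]
  rw [QQ]
  congr 1
  · have := hb 0
    rw [zero_add] at this
    rw [this, sq, Finset.sum_mul_sum]
    simp only [Finset.mul_sum]
  · have : ∀ r, ∑ s ∈ Finset.Icc 1 d, ∑ j ∈ Finset.Icc 1 d, ((j : ℝ) - α) * sibuya α j *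
        ((t r * (cH α r (j + 1) - cH α r j)) * (t s * (cH α s (j + 1) - cH α s j))) =
        ∑ j ∈ Finset.Icc 1 d, ∑ s ∈ Finset.Icc 1 d, ((j : ℝ) - α) * sibuya α j *
        ((t r * (cH α r (j + 1) - cH α r j)) * (t s * (cH α s (j + 1) - cH α s j))) :=
      fun r => Finset.sum_comm
    simp only [this]
    rw [Finset.sum_comm]
    refine Finset.sum_congr rfl fun j _ => ?_
    rw [hb, sq, Finset.sum_mul_sum]
    simp only [Finset.mul_sum]

lemma QQ_nonneg (α : ℝ) (h0 : 0 < α) (h1 : α < 1) (d : ℕ) (t : ℕ → ℝ) : 0 ≤ QQ α d t := by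
  unfold QQ
  refine add_nonneg (by positivity) (Finset.sum_nonneg fun j hj => ?_)
  have : (1 : ℝ) ≤ j := by exact_mod_cast (Finset.mem_Icc.1 hj).1
  have h2 := sibuya_pos α h0 h1 j
  have : 0 ≤ (j : ℝ) - α := by linarith
  positivity

lemma LL_nonneg (α : ℝ) (h0 : 0 < α) (h1 : α < 1) (d : ℕ) (t : ℕ → ℝ) : 0 ≤ LL α d t := by
  have hm : bt α d t 0 = ∑ i ∈ Finset.Icc 1 d, sibuya α i * bt α d t i := by
    simp only [bt, Finset.mul_sum]
    rw [Finset.sum_comm]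
    refine Finset.sum_congr rfl fun r hr => ?_
    rw [← mean_id α d r (Finset.mem_Icc.1 hr).1 (Finset.mem_Icc.1 hr).2, Finset.mul_sum]
    exact Finset.sum_congr rfl fun j _ => by ring
  have hL : LL α d t = ∑ i ∈ Finset.Icc 1 d, sibuya α i * bt α d t i ^ 2 - bt α d t 0 ^ 2 := by
    have h : ∀ r ∈ Finset.Icc 1 d, ∀ s ∈ Finset.Icc 1 d,
        t r * t s * lambdaEntry α r s =
        ∑ i ∈ Finset.Icc 1 d, sibuya α i * ((t r * cH α r i) * (t s * cH α s i)) -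
          (t r * cH α r 0) * (t s * cH α s 0) := by
      intro r hr s hs
      rw [lambda_cov α d r s (Finset.mem_Icc.1 hr).1 (Finset.mem_Icc.1 hr).2, mul_sub, Finset.mul_sum]
      congr 1
      · exact Finset.sum_congr rfl fun j _ => by ring
      · ring
    rw [LL, Finset.sum_congr rfl fun r hr => Finset.sum_congr rfl fun s hs => h r hr s hs]
    simp only [Finset.sum_sub_distrib]
    congr 1
    · have : ∀ r, ∑ s ∈ Finset.Icc 1 d, ∑ i ∈ Finset.Icc 1 d,
          sibuya α i * ((t r * cH α r i) * (t s * cH α s i)) =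
          ∑ i ∈ Finset.Icc 1 d, ∑ s ∈ Finset.Icc 1 d,
          sibuya α i * ((t r * cH α r i) * (t s * cH α s i)) := fun r => Finset.sum_comm
      simp only [this]
      rw [Finset.sum_comm]
      refine Finset.sum_congr rfl fun j _ => ?_
      rw [bt, sq, Finset.sum_mul_sum]
      simp only [Finset.mul_sum]
    · rw [bt, sq, Finset.sum_mul_sum]
  have hcs : bt α d t 0 ^ 2 ≤ (∑ i ∈ Finset.Icc 1 d, sibuya α i) *
      ∑ i ∈ Finset.Icc 1 d, sibuya α i * bt α d t i ^ 2 := by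
    rw [hm]
    refine Finset.sum_sq_le_sum_mul_sum_of_sq_le_mul _ (fun i _ => (sibuya_pos α h0 h1 i).le)
      (fun i _ => mul_nonneg (sibuya_pos α h0 h1 i).le (sq_nonneg _)) (fun i _ => le_of_eq (by ring))
  have hle := sibuya_sum_le α h1 d
  have hn : 0 ≤ ∑ i ∈ Finset.Icc 1 d, sibuya α i * bt α d t i ^ 2 :=
    Finset.sum_nonneg fun i _ => mul_nonneg (sibuya_pos α h0 h1 i).le (sq_nonneg _)
  rw [hL]
  nlinarith [mul_le_mul_of_nonneg_right hle hn]

lemma LL_sh (α N : ℝ) (hN : 0 < N) (d : ℕ) (t : ℕ → ℝ) :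
    LL α d (sh α N t) = LL α d t - QQ α d t / N + (∑ r ∈ Finset.Icc 1 d, ∑ s ∈ Finset.Icc 1 d,
      t r * t s * (((r : ℝ) - α / 2) * ((s : ℝ) - α / 2) * lambdaEntry α r s)) / N ^ 2 := by
  rw [QQ_eq, LL, LL, Finset.sum_div, Finset.sum_div, ← Finset.sum_sub_distrib,
    ← Finset.sum_add_distrib]
  refine Finset.sum_congr rfl fun r _ => ?_
  rw [Finset.sum_div, Finset.sum_div, ← Finset.sum_sub_distrib, ← Finset.sum_add_distrib]
  refine Finset.sum_congr rfl fun s _ => ?_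
  simp only [sh]
  field_simp
  ring

lemma exp_step (x y : ℝ) (hx : 0 ≤ x) (hx1 : x ≤ 1 / 2) (hy : |y| ≤ 1 / 2) :
    |Real.exp (x - y) * (1 - x) - 1| ≤ (x + |y|) ^ 2 + |y| + (x + |y|) * x := by
  have hu : |x - y| ≤ x + |y| := by
    have := abs_sub x y
    rwa [abs_of_nonneg hx] at this
  have h1 := Real.abs_exp_sub_one_sub_id_le (x := x - y) (by linarith)
  have e : Real.exp (x - y) * (1 - x) - 1 =
    (Real.exp (x - y) - 1 - (x - y)) * (1 - x) + (-y) + (-((x - y) * x)) := by ring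
  rw [e]
  refine (abs_add_le _ _).trans (add_le_add ((abs_add_le _ _).trans (add_le_add ?_ ?_)) ?_)
  · rw [abs_mul]
    have h2 : |1 - x| ≤ 1 := by rw [abs_le]; constructor <;> linarith
    have h3 : (x - y) ^ 2 ≤ (x + |y|) ^ 2 := by
      rw [← sq_abs]; gcongr
    calc _ ≤ (x - y) ^ 2 * 1 := by gcongr
      _ ≤ _ := by linarith
  · rw [abs_neg]
  · rw [abs_neg, abs_mul, abs_of_nonneg hx]
    gcongr

lemma G_step (α T : ℝ) (h0 : 0 < α) (h1 : α < 1) (hT : 0 ≤ T) (d : ℕ) :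
    ∃ C N0 : ℝ, 0 ≤ C ∧ 1 ≤ N0 ∧ ∀ (N τ : ℝ) (t : ℕ → ℝ), N0 ≤ N → 0 ≤ τ → τ ≤ T →
      (∀ r ∈ Finset.Icc 1 d, |t r| ≤ τ) →
      |Real.exp (-LL α d (sh α N t) / 2) * (1 - QQ α d t / (2 * N)) - Real.exp (-LL α d t / 2)|
        ≤ C * τ / N ^ 2 ∧ |1 - QQ α d t / (2 * N)| ≤ 1 ∧
      ∀ r ∈ Finset.Icc 1 d, |sh α N t r| ≤ (1 - (1 / 2) / N) * τ := by
  obtain ⟨A, hA0, hAQ, hAR⟩ : ∃ A : ℝ, 0 ≤ A ∧ (∀ (τ : ℝ) (t : ℕ → ℝ), 0 ≤ τ →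
      (∀ r ∈ Finset.Icc 1 d, |t r| ≤ τ) → |QQ α d t| ≤ A * τ ^ 2) ∧
      (∀ (τ : ℝ) (t : ℕ → ℝ), 0 ≤ τ → (∀ r ∈ Finset.Icc 1 d, |t r| ≤ τ) →
       |∑ r ∈ Finset.Icc 1 d, ∑ s ∈ Finset.Icc 1 d,
      t r * t s * (((r : ℝ) - α / 2) * ((s : ℝ) - α / 2) * lambdaEntry α r s)| ≤ A * τ ^ 2) := by
    refine ⟨(∑ r ∈ Finset.Icc 1 d, ∑ s ∈ Finset.Icc 1 d, |((r : ℝ) + s - α) * lambdaEntry α r s|)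
      + ∑ r ∈ Finset.Icc 1 d, ∑ s ∈ Finset.Icc 1 d,
        |((r : ℝ) - α / 2) * ((s : ℝ) - α / 2) * lambdaEntry α r s|, by positivity, ?_, ?_⟩
    · intro τ t hτ ht
      rw [QQ_eq]
      refine (quad_bound d _ t τ hτ ht).trans ?_
      gcongr
      exact le_add_of_nonneg_right (by positivity)
    · intro τ t hτ ht
      refine (quad_bound d _ t τ hτ ht).trans ?_
      gcongr
      exact le_add_of_nonneg_left (by positivity)
  refine ⟨2 * A ^ 2 * T ^ 3 + A * T, 1 + A * T ^ 2 + d, by positivity, ?_, ?_⟩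
  · have : 0 ≤ A * T ^ 2 := by positivity
    have : (0 : ℝ) ≤ d := by positivity
    linarith
  intro N τ t hN hτ hτT ht
  have hAT : 0 ≤ A * T ^ 2 := by positivity
  have hd0 : (0 : ℝ) ≤ d := by positivity
  have hN1 : 1 ≤ N := by linarith
  have hN0 : 0 < N := by linarith
  have hQ := hAQ τ t hτ ht
  have hR := hAR τ t hτ ht
  have hLs := LL_sh α N hN0 d t
  have hQ0 := QQ_nonneg α h0 h1 d t
  have hL0 := LL_nonneg α h0 h1 d t
  rw [abs_of_nonneg hQ0] at hQ
  have hτ2 : A * τ ^ 2 ≤ A * T ^ 2 := by gcongr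
  generalize (∑ r ∈ Finset.Icc 1 d, ∑ s ∈ Finset.Icc 1 d,
      t r * t s * (((r : ℝ) - α / 2) * ((s : ℝ) - α / 2) * lambdaEntry α r s)) = R at hR hLs
  generalize QQ α d t = Q at hQ hLs hQ0 ⊢
  have hx0 : 0 ≤ Q / (2 * N) := by positivity
  have hx1 : Q / (2 * N) ≤ 1 / 2 := by
    rw [div_le_iff₀ (by positivity)]; nlinarith
  refine ⟨?_, ?_, ?_⟩
  · have hyy : |R / (2 * N ^ 2)| ≤ A * τ ^ 2 / (2 * N ^ 2) := by
      rw [abs_div, abs_of_pos (show 0 < 2 * N ^ 2 by positivity)]; gcongr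
    have hyy2 : A * τ ^ 2 / (2 * N ^ 2) ≤ 1 / 2 := by
      rw [div_le_iff₀ (by positivity)]; nlinarith
    have hyy3 : A * τ ^ 2 / (2 * N ^ 2) ≤ A * τ ^ 2 / (2 * N) := by
      gcongr; nlinarith
    have hxx : Q / (2 * N) ≤ A * τ ^ 2 / (2 * N) := by gcongr
    have hs := exp_step (Q / (2 * N)) (R / (2 * N ^ 2)) hx0 hx1 (hyy.trans hyy2)
    have e1 : Real.exp (-LL α d (sh α N t) / 2) =
      Real.exp (-LL α d t / 2) * Real.exp (Q / (2 * N) - R / (2 * N ^ 2)) := by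
      rw [← Real.exp_add, hLs]; congr 1; field_simp; ring
    rw [e1, mul_assoc, ← mul_sub_one, abs_mul, Real.abs_exp]
    have e2 : Real.exp (-LL α d t / 2) ≤ 1 := Real.exp_le_one_iff.2 (by linarith)
    have hX : 0 ≤ A * τ ^ 2 / (2 * N) := by positivity
    calc _ ≤ 1 * ((Q / (2 * N) + |R / (2 * N ^ 2)|) ^ 2 + |R / (2 * N ^ 2)| +
          (Q / (2 * N) + |R / (2 * N ^ 2)|) * (Q / (2 * N))) := by gcongr
      _ ≤ 1 * ((A * τ ^ 2 / (2 * N) + A * τ ^ 2 / (2 * N)) ^ 2 + A * τ ^ 2 / (2 * N ^ 2) +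
          (A * τ ^ 2 / (2 * N) + A * τ ^ 2 / (2 * N)) * (A * τ ^ 2 / (2 * N))) := by
          have := hyy.trans hyy3
          gcongr
      _ = ((3 / 2) * A ^ 2 * τ ^ 3 + A * τ / 2) * τ / N ^ 2 := by field_simp; ring
      _ ≤ _ := by
          have : (3 / 2) * A ^ 2 * τ ^ 3 ≤ 2 * A ^ 2 * T ^ 3 := by gcongr; norm_num
          have : A * τ / 2 ≤ A * T := by
            have : A * τ ≤ A * T := by gcongr
            have : 0 ≤ A * τ := by positivity
            linarith
          gcongr
  · rw [abs_le]; constructor <;> linarith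
  · intro r hr
    have hr1 : (1 : ℝ) ≤ r := by exact_mod_cast (Finset.mem_Icc.1 hr).1
    have hrd : (r : ℝ) ≤ d := by exact_mod_cast (Finset.mem_Icc.1 hr).2
    rw [sh, abs_mul, mul_comm]
    have ha : |1 - ((r : ℝ) - α / 2) / N| ≤ 1 - (1 / 2) / N := by
      have h2 : ((r : ℝ) - α / 2) / N ≤ 1 := by rw [div_le_one hN0]; linarith
      rw [abs_of_nonneg (by linarith)]
      gcongr
      linarith
    have := ht r hr
    have h3 : 0 ≤ 1 - (1 / 2) / N := (abs_nonneg _).trans ha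
    gcongr



section limit
variable {α θ : ℝ} {Ω : Type*} {mΩ : MeasurableSpace Ω} {μ : Measure Ω} {F : Filtration ℕ mΩ}
  {K : ℕ → Ω → ℕ} {B : ℕ → ℕ → Ω → ℕ}

lemma int_exp (hEP : IsEwensPitman α θ μ F K B) (β : ℕ → ℝ) (d n : ℕ) :
    Integrable (fun ω => Complex.exp (Complex.I *
      ((zz β d K B n ω / √(K n ω : ℝ) : ℝ) : ℂ))) μ := by
  have := hEP.prob
  have hm : Measurable (fun ω => zz β d K B n ω / √(K n ω : ℝ)) :=
    (meas_zz' hEP β d n).div (meas_K' hEP n).sqrt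
  refine Integrable.of_bound (C := 1) ?_ (ae_of_all _ fun ω => ?_)
  · exact (Complex.measurable_exp.comp (measurable_const.mul
      (Complex.measurable_ofReal.comp hm))).aestronglyMeasurable
  · rw [mul_comm, Complex.norm_exp_ofReal_mul_I]

lemma ph_base (hEP : IsEwensPitman α θ μ F K B) (h0 : 0 < α) (h1 : α < 1) (d n : ℕ) (hn : 1 ≤ n)
    (T : ℝ) (hT : 0 ≤ T) :
    ∃ A, 0 ≤ A ∧ ∀ (t : ℕ → ℝ) (τ : ℝ), 0 ≤ τ → τ ≤ T → (∀ r ∈ Finset.Icc 1 d, |t r| ≤ τ) →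
      ‖ph μ α d K B n t - ((Real.exp (-LL α d t / 2) : ℝ) : ℂ)‖ ≤ A * τ := by
  have := hEP.prob
  refine ⟨(∑ r ∈ Finset.Icc 1 d, bb (cH α r) d) * n +
    (∑ r ∈ Finset.Icc 1 d, ∑ s ∈ Finset.Icc 1 d, |lambdaEntry α r s|) * T, ?_, ?_⟩
  · have : 0 ≤ ∑ r ∈ Finset.Icc 1 d, bb (cH α r) d := Finset.sum_nonneg fun r _ => bb_nonneg _ _
    positivity
  intro t τ hτ hτT ht
  have hL0 := LL_nonneg α h0 h1 d t
  have hL := quad_bound d (lambdaEntry α) t τ hτ ht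
  rw [← LL, abs_of_nonneg hL0] at hL
  have hp : ‖ph μ α d K B n t - 1‖ ≤ (∑ r ∈ Finset.Icc 1 d, bb (cH α r) d) * n * τ := by
    have e : ph μ α d K B n t - 1 = ∫ ω, (Complex.exp (Complex.I *
        ((zz (bt α d t) d K B n ω / √(K n ω : ℝ) : ℝ) : ℂ)) - 1) ∂μ := by
      rw [integral_sub (int_exp hEP _ d n) (integrable_const _)]
      simp [ph]
    rw [e]
    have hzall : ∀ᵐ ω ∂μ, ∀ r, |zz (cH α r) d K B n ω| ≤ bb (cH α r) d * K n ω :=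
      ae_all_iff.2 fun r => zz_bound hEP (cH α r) d n hn
    have := norm_integral_le_of_norm_le_const (μ := μ) (C := (∑ r ∈ Finset.Icc 1 d, bb (cH α r) d) * n * τ)
      (f := fun ω => Complex.exp (Complex.I *
        ((zz (bt α d t) d K B n ω / √(K n ω : ℝ) : ℝ) : ℂ)) - 1) (by
      filter_upwards [ep_basic hEP n hn, hzall] with ω hω hz
      refine Real.norm_exp_I_mul_ofReal_sub_one_le.trans ?_
      have hK : (1 : ℝ) ≤ K n ω := by exact_mod_cast hω.1
      have hKn : (K n ω : ℝ) ≤ n := by exact_mod_cast hω.2.1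
      have hs : 1 ≤ √(K n ω : ℝ) := Real.one_le_sqrt.2 hK
      rw [Real.norm_eq_abs, abs_div, abs_of_pos (show 0 < √(K n ω : ℝ) by linarith)]
      refine (div_le_self (abs_nonneg _) hs).trans ?_
      rw [zz_bt]
      refine (sum_abs_le d t _ τ ht).trans ?_
      rw [mul_comm τ]
      refine mul_le_mul_of_nonneg_right ?_ hτ
      rw [Finset.sum_mul]
      refine Finset.sum_le_sum fun r _ => (hz r).trans ?_
      have := bb_nonneg (cH α r) d
      gcongr)
    simpa using this
  have hg : ‖(1 : ℂ) - ((Real.exp (-LL α d t / 2) : ℝ) : ℂ)‖ ≤ LL α d t := by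
    rw [← Complex.ofReal_one, ← Complex.ofReal_sub, Complex.norm_real, Real.norm_eq_abs]
    have a1 : Real.exp (-LL α d t / 2) ≤ 1 := Real.exp_le_one_iff.2 (by linarith)
    have a2 := Real.add_one_le_exp (-LL α d t / 2)
    rw [abs_of_nonneg (by linarith)]
    linarith
  calc _ = ‖(ph μ α d K B n t - 1) + (1 - ((Real.exp (-LL α d t / 2) : ℝ) : ℂ))‖ := by
        congr 1; ring
    _ ≤ (∑ r ∈ Finset.Icc 1 d, bb (cH α r) d) * n * τ +
        (∑ r ∈ Finset.Icc 1 d, ∑ s ∈ Finset.Icc 1 d, |lambdaEntry α r s|) * τ ^ 2 :=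
        (norm_add_le _ _).trans (add_le_add hp (hg.trans hL))
    _ ≤ _ := by
        rw [add_mul, sq, ← mul_assoc]
        gcongr

lemma ph_tendsto (hEP : IsEwensPitman α θ μ F K B) (h0 : 0 < α) (h1 : α < 1) (hθ : 0 < α + θ)
    (d : ℕ) (hd : 1 ≤ d) (t : ℕ → ℝ) :
    Tendsto (fun n => ph μ α d K B n t) atTop (𝓝 ((Real.exp (-LL α d t / 2) : ℝ) : ℂ)) := by
  have := hEP.prob
  obtain ⟨T, hT0, hT⟩ : ∃ T : ℝ, 0 ≤ T ∧ ∀ r ∈ Finset.Icc 1 d, |t r| ≤ T :=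
    ⟨∑ r ∈ Finset.Icc 1 d, |t r|, by positivity, fun r hr =>
      Finset.single_le_sum (f := fun r => |t r|) (fun i _ => abs_nonneg _) hr⟩
  obtain ⟨C1, hC1, hrec⟩ := ph_rec hEP h0 h1 hθ d hd T
  obtain ⟨C2, N0, hC2, hN0, hG⟩ := G_step α T h0 h1 hT0 d
  have hNt : Tendsto (fun n : ℕ => (n : ℝ) + θ) atTop atTop :=
    tendsto_atTop_add_const_right _ _ tendsto_natCast_atTop_atTop
  obtain ⟨n0, hn0⟩ := eventually_atTop.1
    (hrec.and ((hNt.eventually_ge_atTop N0).and (eventually_ge_atTop 1)))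
  obtain ⟨A, hA0, hA⟩ := ph_base hEP h0 h1 d n0 (hn0 n0 le_rfl).2.2 T hT0
  obtain ⟨E, hE⟩ : ∃ E : ℕ → ℝ, E = fun n => ∫ ω, err α d K B n ω ∂μ := ⟨_, rfl⟩
  have hE0 : ∀ n, 0 ≤ E n := fun n => by
    rw [hE]; exact integral_nonneg fun ω => by simp only [err]; positivity
  have hElim : Tendsto E atTop (𝓝 0) := by rw [hE]; exact err_tendsto hEP h0 h1 hθ d
  obtain ⟨ε, hε⟩ : ∃ ε : ℕ → ℝ, ε = fun n => C1 * E n + C2 / ((n : ℝ) + θ) := ⟨_, rfl⟩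
  have hεlim : Tendsto ε atTop (𝓝 0) := by
    rw [hε]
    simpa using (hElim.const_mul C1).add (hNt.const_div_atTop C2)
  obtain ⟨q, hq0, hqs⟩ : ∃ q : ℕ → ℝ, q 0 = A ∧ ∀ k, q (k + 1) =
      (1 - (1 / 2) / (((n0 + k : ℕ) : ℝ) + θ)) * q k + ε (n0 + k) / (((n0 + k : ℕ) : ℝ) + θ) :=
    ⟨fun n => Nat.rec A (fun k x => (1 - (1 / 2) / (((n0 + k : ℕ) : ℝ) + θ)) * x +
      ε (n0 + k) / (((n0 + k : ℕ) : ℝ) + θ)) n, rfl, fun k => rfl⟩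
  have hNge : ∀ k, 1 ≤ ((n0 + k : ℕ) : ℝ) + θ := fun k =>
    hN0.trans (hn0 (n0 + k) (by omega)).2.1
  have hqn : ∀ k, 0 ≤ q k := by
    intro k
    induction k with
    | zero => rw [hq0]; exact hA0
    | succ k ih =>
      rw [hqs]
      have h := hNge k
      have h2 : (1 / 2) / (((n0 + k : ℕ) : ℝ) + θ) ≤ 1 := by
        rw [div_le_one (by linarith)]; linarith
      have h3 : 0 ≤ ε (n0 + k) := by
        rw [hε]
        have := hE0 (n0 + k)
        have : 0 ≤ C2 / (((n0 + k : ℕ) : ℝ) + θ) := div_nonneg hC2 (by linarith)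
        positivity
      exact add_nonneg (mul_nonneg (by linarith) ih) (div_nonneg h3 (by linarith))
  have hmain : ∀ k, ∀ (t : ℕ → ℝ) (τ : ℝ), 0 ≤ τ → τ ≤ T → (∀ r ∈ Finset.Icc 1 d, |t r| ≤ τ) →
      ‖ph μ α d K B (n0 + k) t - ((Real.exp (-LL α d t / 2) : ℝ) : ℂ)‖ ≤ q k * τ := by
    intro k
    induction k with
    | zero => rw [hq0]; exact hA
    | succ k ih =>
      intro t τ hτ hτT ht
      have hN1 := hNge k
      have hR := (hn0 (n0 + k) (by omega)).1 t τ hτ hτT ht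
      obtain ⟨g1, g2, g3⟩ := hG (((n0 + k : ℕ) : ℝ) + θ) τ t (hn0 (n0 + k) (by omega)).2.1 hτ hτT ht
      have hEk : ∫ ω, err α d K B (n0 + k) ω ∂μ = E (n0 + k) := by rw [hE]
      rw [hEk] at hR
      rw [hqs, hε]
      beta_reduce
      rw [← add_assoc]
      generalize ((n0 + k : ℕ) : ℝ) + θ = N at *
      have hN : 0 < N := by linarith
      have hf0 : 0 ≤ 1 - (1 / 2) / N := by
        have : (1 / 2) / N ≤ 1 := by rw [div_le_one hN]; linarith
        linarith
      have hf1 : 1 - (1 / 2) / N ≤ 1 := by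
        have : 0 ≤ (1 / 2) / N := by positivity
        linarith
      have hi := ih (sh α N t) ((1 - (1 / 2) / N) * τ) (by positivity)
        ((mul_le_of_le_one_left hτ hf1).trans hτT) g3
      have hgc : ‖((Real.exp (-LL α d (sh α N t) / 2) * (1 - QQ α d t / (2 * N)) -
        Real.exp (-LL α d t / 2) : ℝ) : ℂ)‖ ≤ C2 * τ / N ^ 2 := by
        rw [Complex.norm_real, Real.norm_eq_abs]; exact g1
      have hcn : ‖((1 - QQ α d t / (2 * N) : ℝ) : ℂ)‖ ≤ 1 := by
        rw [Complex.norm_real, Real.norm_eq_abs]; exact g2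
      have hmid : ‖((1 - QQ α d t / (2 * N) : ℝ) : ℂ) * (ph μ α d K B (n0 + k) (sh α N t) -
          ((Real.exp (-LL α d (sh α N t) / 2) : ℝ) : ℂ))‖ ≤ q k * ((1 - (1 / 2) / N) * τ) := by
        rw [norm_mul]
        calc _ ≤ 1 * (q k * ((1 - (1 / 2) / N) * τ)) := by gcongr
          _ = _ := one_mul _
      calc _ = ‖(ph μ α d K B (n0 + k + 1) t - ((1 - QQ α d t / (2 * N) : ℝ) : ℂ) *
            ph μ α d K B (n0 + k) (sh α N t)) +
            ((1 - QQ α d t / (2 * N) : ℝ) : ℂ) * (ph μ α d K B (n0 + k) (sh α N t) -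
              ((Real.exp (-LL α d (sh α N t) / 2) : ℝ) : ℂ)) +
            ((Real.exp (-LL α d (sh α N t) / 2) * (1 - QQ α d t / (2 * N)) -
              Real.exp (-LL α d t / 2) : ℝ) : ℂ)‖ := by
            congr 1
            rw [Complex.ofReal_sub (Real.exp _ * _), Complex.ofReal_mul]
            ring
        _ ≤ C1 * τ * E (n0 + k) / N + q k * ((1 - (1 / 2) / N) * τ) + C2 * τ / N ^ 2 :=
            (norm_add_le _ _).trans (add_le_add ((norm_add_le _ _).trans (add_le_add hR hmid)) hgc)
        _ = _ := by field_simp; ring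
  have hx : Tendsto (fun n => q (n - n0)) atTop (𝓝 0) := by
    refine gron θ (1 / 2) (by norm_num) _ ε (fun n => hqn _) hεlim ?_
    filter_upwards [eventually_ge_atTop n0] with n hn
    obtain ⟨k, rfl⟩ := Nat.exists_eq_add_of_le hn
    rw [show n0 + k + 1 - n0 = k + 1 by omega, show n0 + k - n0 = k by omega, hqs]
  rw [tendsto_iff_norm_sub_tendsto_zero]
  refine squeeze_zero' (Eventually.of_forall fun _ => norm_nonneg _) ?_
    (by simpa using hx.mul_const T)
  filter_upwards [eventually_ge_atTop n0] with n hn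
  obtain ⟨k, rfl⟩ := Nat.exists_eq_add_of_le hn
  rw [show n0 + k - n0 = k by omega]
  exact hmain k t T hT0 le_rfl hT

end limit



lemma sum_Icc_fin (d : ℕ) (f : ℕ → ℝ) :
    ∑ r ∈ Finset.Icc 1 d, f r = ∑ i : Fin d, f (i.val + 1) := by
  have h : Finset.Icc 1 d = Finset.Ico 1 (d + 1) := by ext i; simp
  rw [h, Finset.sum_Ico_eq_sum_range, Nat.add_sub_cancel, Finset.sum_range]
  simp only [add_comm 1]

def ext0 (d : ℕ) (x : Fin d → ℝ) (r : ℕ) : ℝ := if h : r - 1 < d then x ⟨r - 1, h⟩ else 0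

lemma ext0_succ (d : ℕ) (x : Fin d → ℝ) (i : Fin d) : ext0 d x (i.val + 1) = x i := by
  simp [ext0]

def SS (α : ℝ) (d : ℕ) : Matrix (Fin d) (Fin d) ℝ :=
  fun i j => lambdaEntry α (i.val + 1) (j.val + 1)

lemma LL_ext (α : ℝ) (d : ℕ) (x : Fin d → ℝ) : LL α d (ext0 d x) =
    ∑ i, ∑ j, x i * lambdaEntry α (i.val + 1) (j.val + 1) * x j := by
  rw [LL, sum_Icc_fin]
  refine Finset.sum_congr rfl fun i _ => ?_
  rw [sum_Icc_fin]
  refine Finset.sum_congr rfl fun j _ => ?_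
  rw [ext0_succ, ext0_succ]; ring

lemma dot_SS (α : ℝ) (d : ℕ) (x : Fin d → ℝ) :
    dotProduct x ((SS α d).mulVec x) = LL α d (ext0 d x) := by
  rw [LL_ext]
  simp only [dotProduct, Matrix.mulVec, SS, Finset.mul_sum, mul_assoc]

lemma SS_psd (α : ℝ) (h0 : 0 < α) (h1 : α < 1) (d : ℕ) : (SS α d).PosSemidef := by
  refine Matrix.PosSemidef.of_dotProduct_mulVec_nonneg ?_ fun x => ?_
  · ext i j
    simp only [Matrix.conjTranspose_apply, SS, star_trivial, lambdaEntry]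
    rw [add_comm (j.val + 1), mul_comm ((Nat.factorial (j.val + 1) : ℕ) : ℝ)]
  · rw [star_trivial, dot_SS]
    exact LL_nonneg α h0 h1 d _

lemma comp_eq {Ω : Type*} (α : ℝ) (d : ℕ) (K : ℕ → Ω → ℕ) (B : ℕ → ℕ → Ω → ℕ) (n : ℕ) (ω : Ω)
    (hK : 1 ≤ K n ω) (r : ℕ) (hr : r + 1 ≤ d) :
    Real.sqrt (K n ω : ℝ) * (∑ i ∈ Finset.Icc 1 (r + 1),
        bCoef α (r + 1) i * ((B i n ω : ℝ) / (K n ω : ℝ)) +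
      (-1 : ℝ) ^ (r + 1) * sibuya α (r + 1)) = zz (cH α (r + 1)) d K B n ω / √(K n ω : ℝ) := by
  have hk : (0 : ℝ) < K n ω := by exact_mod_cast hK
  have e1 : ∑ i ∈ Finset.Icc 1 (r + 1), bCoef α (r + 1) i * ((B i n ω : ℝ) / (K n ω : ℝ)) =
      ∑ i ∈ Finset.Icc 1 d, cH α (r + 1) i * ((B i n ω : ℝ) / (K n ω : ℝ)) := by
    rw [Finset.sum_congr rfl fun i hi => by
      rw [bCoef_eq α (r + 1) i (Finset.mem_Icc.1 hi).2]]
    refine Finset.sum_subset (Finset.Icc_subset_Icc_right hr) fun i hi hi2 => ?_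
    have : ¬ i ≤ r + 1 := fun h => hi2 (Finset.mem_Icc.2 ⟨(Finset.mem_Icc.1 hi).1, h⟩)
    simp [cH, this]
  have e2 : (-1 : ℝ) ^ (r + 1) * sibuya α (r + 1) = - cH α (r + 1) 0 := by
    rw [sibuya_eq α (r + 1) (by omega), cH, if_pos (by omega)]
    have : (-1 : ℝ) ^ (r + 1) * (-1 : ℝ) ^ (r + 1) = 1 := by
      rw [← mul_pow]; norm_num
    simp only [Nat.cast_zero, sub_zero, Nat.sub_zero]
    linear_combination (-gb α (r + 1)) * this
  rw [e1, e2, zz, eq_div_iff (by positivity)]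
  have hs := Real.mul_self_sqrt hk.le
  have e3 : ∑ i ∈ Finset.Icc 1 d, cH α (r + 1) i * ((B i n ω : ℝ) / (K n ω : ℝ)) =
     (∑ i ∈ Finset.Icc 1 d, cH α (r + 1) i * (B i n ω : ℝ)) / K n ω := by
    rw [Finset.sum_div]; exact Finset.sum_congr rfl fun i _ => by ring
  rw [e3]
  generalize ∑ i ∈ Finset.Icc 1 d, cH α (r + 1) i * (B i n ω : ℝ) = a
  have : √(K n ω : ℝ) * (a / (K n ω : ℝ) + -cH α (r + 1) 0) * √(K n ω : ℝ) =
    (√(K n ω : ℝ) * √(K n ω : ℝ)) * (a / (K n ω : ℝ) + -cH α (r + 1) 0) := by ring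
  rw [this, hs]
  field_simp
  ring

section final
variable {α θ : ℝ} {Ω : Type*} {mΩ : MeasurableSpace Ω} {μ : Measure Ω} {F : Filtration ℕ mΩ}
  {K : ℕ → Ω → ℕ} {B : ℕ → ℕ → Ω → ℕ}

def XX (α : ℝ) (d : ℕ) (K : ℕ → Ω → ℕ) (B : ℕ → ℕ → Ω → ℕ) (n : ℕ) (ω : Ω) : Fin d → ℝ :=
  fun r : Fin d => Real.sqrt (K n ω : ℝ) *
            (∑ i ∈ Finset.Icc 1 (r.val + 1),
                bCoef α (r.val + 1) i * ((B i n ω : ℝ) / (K n ω : ℝ)) +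
              (-1 : ℝ) ^ (r.val + 1) * sibuya α (r.val + 1))

lemma XX_meas (hEP : IsEwensPitman α θ μ F K B) (d n : ℕ) : Measurable (XX α d K B n) := by
  refine measurable_pi_lambda _ fun r => ?_
  refine (meas_K' hEP n).sqrt.mul ((Finset.measurable_fun_sum _ fun i _ => ?_).add_const _)
  exact ((meas_B' hEP i n).div (meas_K' hEP n)).const_mul _

lemma charFun_XX (hEP : IsEwensPitman α θ μ F K B) (d n : ℕ) (hn : 1 ≤ n)
    (x : EuclideanSpace ℝ (Fin d)) :
    charFun (μ.map (fun ω => WithLp.toLp 2 (XX α d K B n ω))) x = ph μ α d K B n (ext0 d x) := by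
  have hm := XX_meas hEP d n
  rw [charFun_apply, integral_map (by fun_prop) (by fun_prop), ph]
  refine integral_congr_ae ?_
  filter_upwards [ep_basic hEP n hn] with ω hω
  have : inner ℝ (WithLp.toLp 2 (XX α d K B n ω)) x =
      zz (bt α d (ext0 d x)) d K B n ω / √(K n ω : ℝ) := by
    rw [zz_bt, sum_Icc_fin, Finset.sum_div, PiLp.inner_apply]
    refine Finset.sum_congr rfl fun i _ => ?_
    rw [ext0_succ, mul_div_assoc, ← comp_eq α d K B n ω hω.1 i.val i.isLt]
    simp [XX]
  rw [this, mul_comm]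

end final

/-- Multi-dimensional CLT: the vector with `r`-th component
`√(K_n) (∑_{i=1}^r b_{r,i} P_{i,n} + (-1)^r p_α(r))`, `1 ≤ r ≤ d`, converges in
distribution to a centered `d`-dimensional Gaussian with covariance matrix `Λ_d`
(characterized by the fact that each linear functional `x ↦ ∑ᵢ aᵢ xᵢ` is a centered
real Gaussian with variance `aᵀ Λ_d a`). -/
theorem multidim_clt (α θ : ℝ) (hα0 : 0 < α) (hα1 : α < 1) (hθ : 0 < α + θ)
    {Ω : Type*} [mΩ : MeasurableSpace Ω] (μ : Measure Ω) (F : Filtration ℕ mΩ)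
    (K : ℕ → Ω → ℕ) (B : ℕ → ℕ → Ω → ℕ) (hEP : IsEwensPitman α θ μ F K B)
    (d : ℕ) (hd : 1 ≤ d) :
    ∃ ν : Measure (Fin d → ℝ), IsProbabilityMeasure ν ∧
      (∀ a : Fin d → ℝ,
        ν.map (fun x => ∑ i, a i * x i) =
          gaussianReal 0 (Real.toNNReal
            (∑ i, ∑ j, a i * lambdaEntry α (i.val + 1) (j.val + 1) * a j))) ∧
      ∀ f : BoundedContinuousFunction (Fin d → ℝ) ℝ,
        Tendsto
          (fun n => ∫ ω, f (fun r : Fin d => Real.sqrt (K n ω : ℝ) *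
            (∑ i ∈ Finset.Icc 1 (r.val + 1),
                bCoef α (r.val + 1) i * ((B i n ω : ℝ) / (K n ω : ℝ)) +
              (-1 : ℝ) ^ (r.val + 1) * sibuya α (r.val + 1))) ∂μ)
          atTop
          (𝓝 (∫ x, f x ∂ν)) := by
  have hprob := hEP.prob
  have hS := SS_psd α hα0 hα1 d
  have hof : Measurable (fun x : EuclideanSpace ℝ (Fin d) => (WithLp.ofLp x : Fin d → ℝ)) := by
    fun_prop
  have hcf : ∀ x : EuclideanSpace ℝ (Fin d), charFun (multivariateGaussian 0 (SS α d)) x =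
      ((Real.exp (-LL α d (ext0 d x) / 2) : ℝ) : ℂ) := by
    intro x
    rw [charFun_multivariateGaussian hS, dot_SS, Complex.ofReal_exp]
    congr 1
    simp
    ring
  refine ⟨(multivariateGaussian 0 (SS α d)).map (fun x => WithLp.ofLp x),
    Measure.isProbabilityMeasure_map hof.aemeasurable, ?_, ?_⟩
  · intro a
    rw [Measure.map_map (by fun_prop) hof]
    apply Measure.ext_of_charFun
    ext s
    rw [charFun_gaussianReal, charFun_apply, integral_map (by fun_prop) (by fun_prop)]
    have h := hcf (WithLp.toLp 2 (s • a))
    rw [charFun_apply] at h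
    have e : ∀ x : EuclideanSpace ℝ (Fin d),
        inner ℝ (((fun x : Fin d → ℝ => ∑ i, a i * x i) ∘ fun x : EuclideanSpace ℝ (Fin d) =>
          (WithLp.ofLp x : Fin d → ℝ)) x) s = inner ℝ x (WithLp.toLp 2 (s • a)) := by
      intro x
      rw [PiLp.inner_apply]
      simp [Finset.mul_sum, Finset.sum_mul]
      refine Finset.sum_congr rfl fun i _ => by ring
    simp only [e]
    rw [h, Complex.ofReal_exp]
    congr 1
    have hnn := LL_nonneg α hα0 hα1 d (ext0 d a)
    rw [LL_ext] at hnn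
    rw [Real.coe_toNNReal _ hnn, LL_ext]
    have : ∑ i, ∑ j, (s • a) i * lambdaEntry α (i.val + 1) (j.val + 1) * (s • a) j =
      s ^ 2 * ∑ i, ∑ j, a i * lambdaEntry α (i.val + 1) (j.val + 1) * a j := by
      simp only [Finset.mul_sum]
      refine Finset.sum_congr rfl fun i _ => Finset.sum_congr rfl fun j _ => ?_
      simp only [Pi.smul_apply, smul_eq_mul]; ring
    rw [this]
    push_cast
    ring
  · intro f
    have hm := XX_meas hEP d
    have hm2 : ∀ n, AEMeasurable (fun ω => WithLp.toLp 2 (XX α d K B n ω)) μ := fun n => by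
      have := hm n
      fun_prop
    let P : ℕ → ProbabilityMeasure (EuclideanSpace ℝ (Fin d)) := fun n =>
      ⟨μ.map (fun ω => WithLp.toLp 2 (XX α d K B n ω)), Measure.isProbabilityMeasure_map (hm2 n)⟩
    let P0 : ProbabilityMeasure (EuclideanSpace ℝ (Fin d)) :=
      ⟨multivariateGaussian 0 (SS α d), inferInstance⟩
    have hP : Tendsto P atTop (𝓝 P0) := by
      refine ProbabilityMeasure.tendsto_of_tendsto_charFun fun x => ?_
      show Tendsto (fun n => charFun (μ.map (fun ω => WithLp.toLp 2 (XX α d K B n ω))) x) atTop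
        (𝓝 (charFun (multivariateGaussian 0 (SS α d)) x))
      rw [hcf]
      refine (ph_tendsto hEP hα0 hα1 hθ d hd (ext0 d x)).congr' ?_
      filter_upwards [eventually_ge_atTop 1] with n hn
      exact (charFun_XX hEP d n hn x).symm
    have h := ProbabilityMeasure.tendsto_iff_forall_integral_tendsto.1 hP
      (f.compContinuous ⟨fun x : EuclideanSpace ℝ (Fin d) => (WithLp.ofLp x : Fin d → ℝ),
        by fun_prop⟩)
    have hcont := f.continuous
    rw [integral_map hof.aemeasurable (by fun_prop)]
    refine Tendsto.congr (fun n => ?_) h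
    show ∫ x, f (WithLp.ofLp x) ∂(μ.map (fun ω => WithLp.toLp 2 (XX α d K B n ω))) = _
    rw [integral_map (hm2 n) (by fun_prop)]
    rfl

end
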